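/- arXiv:2504.14163 — 14 statements merged into one kernel-verified Lean document; each statement's English description precedes it below -/
import Mathlib

section
/- Let K ≥ 1 be an integer and let x_1, …, x_K ∈ [0,1] satisfy ∑_{k=1}^K x_k ≤ 1. Then 1 − ∏_{k=1}^K (1 − x_k) ≥ (1 − (1 − 1/K)^K) · ∑_{k=1}^K x_k. -/
/-- For `K ≥ 1` and `x_1, …, x_K ∈ [0,1]` with `∑ x_k ≤ 1`,
`1 − ∏ (1 − x_k) ≥ (1 − (1 − 1/K)^K) · ∑ x_k`. -/
theorem stmt0 (K : ℕ) (hK : 1 ≤ K) (x : Fin K → ℝ)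
    (hx0 : ∀ k, 0 ≤ x k) (hx1 : ∀ k, x k ≤ 1) (hsum : ∑ k, x k ≤ 1) :
    1 - ∏ k, (1 - x k) ≥ (1 - (1 - 1 / (K : ℝ)) ^ K) * ∑ k, x k := by
  have hK1 : (1 : ℝ) ≤ K := by exact_mod_cast hK
  have hK0 : (K : ℝ) ≠ 0 := by positivity
  have hz : ∀ k, 0 ≤ 1 - x k := fun k => sub_nonneg.2 (hx1 k)
  have hS : 0 ≤ ∑ k, x k := Finset.sum_nonneg fun k _ => hx0 k
  have h1 := Real.geom_mean_le_arith_mean_weighted Finset.univ (fun _ : Fin K => (K : ℝ)⁻¹)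
    (fun k => 1 - x k) (fun _ _ => by positivity) (by simp [hK0]) (fun k _ => hz k)
  have h2 : ∏ k, (1 - x k) ≤ (1 - (∑ k, x k) / K) ^ K := by
    have h3 := pow_le_pow_left₀
      (Finset.prod_nonneg fun k _ => Real.rpow_nonneg (hz k) _) h1 K
    rw [← Finset.prod_pow] at h3
    have h4 : ∀ k, ((1 - x k) ^ ((K : ℝ)⁻¹)) ^ K = 1 - x k := fun k =>
      Real.rpow_inv_natCast_pow (hz k) (by omega)
    simp only [h4] at h3
    refine h3.trans_eq ?_
    congr 1
    rw [← Finset.mul_sum, Finset.sum_sub_distrib]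
    simp
    field_simp
  have h5 : (0 : ℝ) ≤ 1 - 1 / K := by
    rw [sub_nonneg, div_le_one (by positivity)]; exact hK1
  have h6 := (convexOn_pow (𝕜 := ℝ) K).2 (x := 1) (y := 1 - 1 / (K : ℝ))
    (by simp) h5 (sub_nonneg.2 hsum) hS (by ring)
  simp only [smul_eq_mul, one_pow] at h6
  have h7 : (1 - ∑ k, x k) * 1 + (∑ k, x k) * (1 - 1 / (K : ℝ)) = 1 - (∑ k, x k) / K := by ring
  rw [h7] at h6
  linarith
end

section
/- Suppose the locations are independent, σ is a decentralized signaling mechanism with signal set U = {0,1}^K given by components σ_1, …, σ_K, and f ∈ F_d. Then T(σ, f) = ∑_{u ∈ U, u ≠ 𝟎} ∏_{k=1}^K ( ∑_{ω_k ∈ Ω_k} μ_k(ω_k) σ_k(u_k|ω_k) ) = 1 − ∏_{k=1}^K ( 1 − ∑_{ω_k ∈ Ω_k} μ_k(ω_k) σ_k(1|ω_k) ). In particular, for such σ the throughput T(σ, f) does not depend on the choice of f ∈ F_d. -/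
open Finset in
/-- A probability distribution on a finite type. -/
def IsDist {α : Type*} [Fintype α] (ν : α → ℝ) : Prop :=
  (∀ a, 0 ≤ ν a) ∧ ∑ a, ν a = 1

open Finset in
/-- A signaling mechanism with (finite) signal set `S`: `σ ω s` is the probability of
sending signal `s` in state `ω`. -/
def IsMech {Ωt : Type*} {S : Type*} [Fintype S] (σ : Ωt → S → ℝ) : Prop :=
  (∀ ω s, 0 ≤ σ ω s) ∧ ∀ ω, ∑ s, σ ω s = 1

open Finset in
/-- A customer strategy on signal set `S`, choosing actions in `Option (Fin K)`
(`none` = do not join, `some k` = join location `k`). -/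
def IsStrat {S : Type*} [Fintype S] (K : ℕ) (f : S → Option (Fin K) → ℝ) : Prop :=
  (∀ s a, 0 ≤ f s a) ∧ ∀ s, ∑ a, f s a = 1

/-- The customer's utility for an action, with the convention `h_0 ≡ 0`. -/
def util {K : ℕ} {Ω : Fin K → Type*} (h : ∀ k, Ω k → ℝ) (ω : ∀ k, Ω k) :
    Option (Fin K) → ℝ
  | none => 0
  | some k => h k (ω k)

open Finset in
/-- Optimality of a strategy `f` under a mechanism `σ` (unnormalized posterior form). -/
def IsOptimal {K : ℕ} {Ω : Fin K → Type*} [∀ k, Fintype (Ω k)] {S : Type*} [Fintype S]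
    (μ : (∀ k, Ω k) → ℝ) (h : ∀ k, Ω k → ℝ)
    (σ : (∀ k, Ω k) → S → ℝ) (f : S → Option (Fin K) → ℝ) : Prop :=
  ∀ s : S, 0 < ∑ ω, μ ω * σ ω s → ∀ a, 0 < f s a → ∀ a',
    ∑ ω, μ ω * σ ω s * util h ω a' ≤ ∑ ω, μ ω * σ ω s * util h ω a

open Finset in
/-- The throughput `T(σ, f)`. -/
noncomputable def T {K : ℕ} {Ω : Fin K → Type*} [∀ k, Fintype (Ω k)] {S : Type*} [Fintype S]
    (μ : (∀ k, Ω k) → ℝ) (σ : (∀ k, Ω k) → S → ℝ) (f : S → Option (Fin K) → ℝ) : ℝ :=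
  ∑ ω, ∑ s, ∑ k : Fin K, μ ω * σ ω s * f s (some k)

/-- The class `F_d` of strategies on the binary signal set `U = {0,1}^K`. -/
def InFd {K : ℕ} (f : (Fin K → Bool) → Option (Fin K) → ℝ) : Prop :=
  IsStrat K f ∧ (∀ u : Fin K → Bool, u ≠ (fun _ => false) → f u none = 0) ∧
    ∀ (u : Fin K → Bool) (k : Fin K), u k = false → f u (some k) = 0

open Finset in
/-- Feasibility for the isolated linear program for `(ν, h)`: `g ω` is the probability of
sending signal `1` in state `ω`. -/
def IsoFeas {α : Type*} [Fintype α] (ν h g : α → ℝ) : Prop :=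
  (∀ a, 0 ≤ g a) ∧ (∀ a, g a ≤ 1) ∧
    0 ≤ ∑ a, ν a * g a * h a ∧ ∑ a, ν a * (1 - g a) * h a ≤ 0

open Finset in
/-- The optimal value `Th^iso(ν, h)` of the isolated linear program. -/
noncomputable def ThIso {α : Type*} [Fintype α] (ν h : α → ℝ) : ℝ :=
  sSup {x | ∃ g, IsoFeas ν h g ∧ x = ∑ a, ν a * g a}

open Finset in
/-- An obedient direct mechanism (signals are action recommendations in `Option (Fin K)`). -/
def Obedient {K : ℕ} {Ω : Fin K → Type*} [∀ k, Fintype (Ω k)]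
    (μ : (∀ k, Ω k) → ℝ) (h : ∀ k, Ω k → ℝ)
    (σ : (∀ k, Ω k) → Option (Fin K) → ℝ) : Prop :=
  (∀ k l : Fin K, ∑ ω, μ ω * σ ω (some k) * h l (ω l) ≤ ∑ ω, μ ω * σ ω (some k) * h k (ω k)) ∧
  (∀ k : Fin K, 0 ≤ ∑ ω, μ ω * σ ω (some k) * h k (ω k)) ∧
  (∀ k : Fin K, ∑ ω, μ ω * σ ω none * h k (ω k) ≤ 0)

open Finset in
/-- Throughput of any strategy in `F_d`. -/
theorem T_eq_of_InFd {K : ℕ} {Ω : Fin K → Type} [∀ k, Fintype (Ω k)]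
    (μk : ∀ k, Ω k → ℝ) (σk : ∀ k, Ω k → Bool → ℝ)
    (f : (Fin K → Bool) → Option (Fin K) → ℝ) (hf : InFd f) :
    T (fun ω => ∏ k, μk k (ω k)) (fun ω u => ∏ k, σk k (ω k) (u k)) f =
        ∑ u ∈ Finset.univ.filter (fun u : Fin K → Bool => u ≠ fun _ => false),
          ∏ k, ∑ ωk, μk k ωk * σk k ωk (u k) := by
  obtain ⟨⟨_, hs⟩, h0, h1⟩ := hf
  have key : ∀ u : Fin K → Bool, ∑ k : Fin K, f u (some k) =
      if u ≠ (fun _ => false) then 1 else 0 := by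
    intro u
    split_ifs with hu
    · have := hs u
      rw [Fintype.sum_option, h0 u hu, zero_add] at this
      exact this
    · push Not at hu
      subst hu
      exact Finset.sum_eq_zero fun k _ => h1 _ k rfl
  unfold T
  rw [Finset.sum_comm, Finset.sum_filter]
  refine Finset.sum_congr rfl fun u _ => ?_
  simp_rw [← Finset.mul_sum, key]
  split_ifs with hu
  · simp_rw [mul_one, ← Finset.prod_mul_distrib]
    rw [Fintype.prod_sum]
  · simp

open Finset in
/-- For independent locations, a decentralized mechanism with binary
signals `U = {0,1}^K`, and any `f ∈ F_d`, the throughput equals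
`∑_{u ≠ 0} ∏_k (∑_{ω_k} μ_k(ω_k) σ_k(u_k|ω_k)) = 1 − ∏_k (1 − ∑_{ω_k} μ_k(ω_k) σ_k(1|ω_k))`;
in particular, it does not depend on the choice of `f ∈ F_d`. -/
theorem stmt2 {K : ℕ} (hK : 1 ≤ K) {Ω : Fin K → Type} [∀ k, Fintype (Ω k)]
    [∀ k, Nonempty (Ω k)]
    (μk : ∀ k, Ω k → ℝ) (hμ : ∀ k, IsDist (μk k))
    (h : ∀ k, Ω k → ℝ)
    (σk : ∀ k, Ω k → Bool → ℝ) (hσ : ∀ k, IsMech (σk k))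
    (f : (Fin K → Bool) → Option (Fin K) → ℝ) (hf : InFd f) :
    T (fun ω => ∏ k, μk k (ω k)) (fun ω u => ∏ k, σk k (ω k) (u k)) f =
        ∑ u ∈ Finset.univ.filter (fun u : Fin K → Bool => u ≠ fun _ => false),
          ∏ k, ∑ ωk, μk k ωk * σk k ωk (u k) ∧
      T (fun ω => ∏ k, μk k (ω k)) (fun ω u => ∏ k, σk k (ω k) (u k)) f =
        1 - ∏ k, (1 - ∑ ωk, μk k ωk * σk k ωk true) ∧
      ∀ f' : (Fin K → Bool) → Option (Fin K) → ℝ, InFd f' →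
        T (fun ω => ∏ k, μk k (ω k)) (fun ω u => ∏ k, σk k (ω k) (u k)) f' =
          T (fun ω => ∏ k, μk k (ω k)) (fun ω u => ∏ k, σk k (ω k) (u k)) f := by
  have hT := T_eq_of_InFd μk σk f hf
  refine ⟨hT, ?_, fun f' hf' => (T_eq_of_InFd μk σk f' hf').trans hT.symm⟩
  rw [hT]
  have hsum : ∀ k, ∑ b : Bool, ∑ ωk, μk k ωk * σk k ωk b = 1 := by
    intro k
    rw [Finset.sum_comm]
    simp_rw [← Finset.mul_sum, (hσ k).2, mul_one]
    exact (hμ k).2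
  have htot : ∑ u : Fin K → Bool, ∏ k, ∑ ωk, μk k ωk * σk k ωk (u k) = 1 := by
    rw [← Fintype.prod_sum (fun k b => ∑ ωk, μk k ωk * σk k ωk b)]
    simp_rw [hsum]
    simp
  have hfalse : ∀ k, 1 - ∑ ωk, μk k ωk * σk k ωk true = ∑ ωk, μk k ωk * σk k ωk false := by
    intro k
    have := hsum k
    rw [Fintype.sum_bool] at this
    linarith
  simp_rw [hfalse]
  rw [Finset.filter_ne', ← htot,
    ← Finset.add_sum_erase _ _ (Finset.mem_univ (fun _ : Fin K => false))]
  ring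
end

section
/- Suppose the locations are independent. Let S = S_1 × ⋯ × S_K with each S_k finite and nonempty, and let σ be a decentralized signaling mechanism with signal set S. Then there exist a decentralized signaling mechanism ψ with signal set U = {0,1}^K and a strategy f̂ ∈ F_d such that: (1) f̂ is optimal under ψ; and (2) T(ψ, f̂) ≥ T(σ, f) for every strategy f on S that is optimal under σ. -/
/-- Probability of signal `s` at a location. -/
noncomputable def sP {α β : Type} [Fintype α] (ν : α → ℝ) (σ : α → β → ℝ) (s : β) : ℝ :=
  ∑ x, ν x * σ x s

/-- Unnormalized conditional mean utility of signal `s` at a location. -/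
noncomputable def sM {α β : Type} [Fintype α] (ν h : α → ℝ) (σ : α → β → ℝ) (s : β) : ℝ :=
  ∑ x, ν x * σ x s * h x

open Finset in
theorem sP_nonneg {α β : Type} [Fintype α] [Fintype β] {ν : α → ℝ} {σ : α → β → ℝ}
    (hν : IsDist ν) (hσ : IsMech σ) (s : β) : 0 ≤ sP ν σ s :=
  sum_nonneg fun x _ => mul_nonneg (hν.1 x) (hσ.1 x s)

open Finset in
theorem sP_sum {α β : Type} [Fintype α] [Fintype β] {ν : α → ℝ} {σ : α → β → ℝ}
    (hν : IsDist ν) (hσ : IsMech σ) : ∑ s, sP ν σ s = 1 := by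
  unfold sP
  rw [sum_comm]
  simp_rw [← mul_sum, hσ.2, mul_one]
  exact hν.2

open Finset in
theorem sum_pi_prod {K : ℕ} {Ω : Fin K → Type} [∀ k, Fintype (Ω k)] (w : ∀ k, Ω k → ℝ) :
    ∑ ω : (∀ k, Ω k), ∏ k, w k (ω k) = ∏ k, ∑ x, w k x := by
  rw [prod_univ_sum, Fintype.piFinset_univ]

open Finset in
theorem fact1 {K : ℕ} {Ω Sk : Fin K → Type} [∀ k, Fintype (Ω k)]
    (μk : ∀ k, Ω k → ℝ) (σk : ∀ k, Ω k → Sk k → ℝ) (s : ∀ k, Sk k) :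
    ∑ ω : (∀ k, Ω k), (∏ k, μk k (ω k)) * ∏ k, σk k (ω k) (s k) =
      ∏ k, sP (μk k) (σk k) (s k) := by
  simp_rw [← prod_mul_distrib]
  exact sum_pi_prod (fun k x => μk k x * σk k x (s k))

open Finset in
theorem fact2 {K : ℕ} {Ω Sk : Fin K → Type} [∀ k, Fintype (Ω k)]
    (μk : ∀ k, Ω k → ℝ) (h : ∀ k, Ω k → ℝ) (σk : ∀ k, Ω k → Sk k → ℝ) (s : ∀ k, Sk k)
    (k : Fin K) :
    ∑ ω : (∀ k, Ω k), (∏ k, μk k (ω k)) * (∏ k, σk k (ω k) (s k)) * h k (ω k) =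
      sM (μk k) (h k) (σk k) (s k) * ∏ j ∈ univ.erase k, sP (μk j) (σk j) (s j) := by
  have e : ∀ ω : (∀ k, Ω k), (∏ k, μk k (ω k)) * (∏ k, σk k (ω k) (s k)) * h k (ω k) =
      ∏ j, (μk j (ω j) * σk j (ω j) (s j) * if j = k then h j (ω j) else 1) := by
    intro ω
    rw [prod_mul_distrib, prod_mul_distrib]
    simp
  simp_rw [e]
  rw [sum_pi_prod (fun j x => μk j x * σk j x (s j) * if j = k then h j x else 1),
    ← mul_prod_erase univ _ (mem_univ k)]
  congr 1
  · simp [sM]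
  · apply prod_congr rfl
    intro j hj
    simp [sP, (mem_erase.1 hj).1]

open Finset in
theorem T_eq {K : ℕ} {Ω Sk : Fin K → Type} [∀ k, Fintype (Ω k)] [∀ k, Fintype (Sk k)]
    (μk : ∀ k, Ω k → ℝ) (hμ : ∀ k, IsDist (μk k))
    (σk : ∀ k, Ω k → Sk k → ℝ) (hσ : ∀ k, IsMech (σk k))
    (f : (∀ k, Sk k) → Option (Fin K) → ℝ) (hf : IsStrat K f) :
    T (fun ω => ∏ k, μk k (ω k)) (fun ω s => ∏ k, σk k (ω k) (s k)) f =
      1 - ∑ s : (∀ k, Sk k), (∏ k, sP (μk k) (σk k) (s k)) * f s none := by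
  have h1 : ∑ s : (∀ k, Sk k), (∏ k, sP (μk k) (σk k) (s k)) = 1 := by
    rw [sum_pi_prod (fun k x => sP (μk k) (σk k) x)]
    exact prod_eq_one fun k _ => sP_sum (hμ k) (hσ k)
  unfold T
  rw [sum_comm, ← h1, ← sum_sub_distrib]
  apply sum_congr rfl
  intro s _
  have h2 : ∑ k, f s (some k) = 1 - f s none := by
    have := hf.2 s
    rw [Fintype.sum_option] at this
    linarith
  simp_rw [← mul_sum, h2]
  rw [← sum_mul, fact1]
  ring

open Finset in
/-- Lemma 1. For independent locations and any decentralized mechanism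
`σ` with signal set `S = S_1 × ⋯ × S_K`, there exist a decentralized mechanism `ψ` with
binary signals `U = {0,1}^K` and a strategy `f̂ ∈ F_d` such that `f̂` is optimal under `ψ`
and `T(ψ, f̂) ≥ T(σ, f)` for every strategy `f` that is optimal under `σ`. -/
theorem stmt3 {K : ℕ} (hK : 1 ≤ K) {Ω : Fin K → Type} [∀ k, Fintype (Ω k)]
    [∀ k, Nonempty (Ω k)]
    {Sk : Fin K → Type} [∀ k, Fintype (Sk k)] [∀ k, Nonempty (Sk k)]
    (μk : ∀ k, Ω k → ℝ) (hμ : ∀ k, IsDist (μk k))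
    (h : ∀ k, Ω k → ℝ)
    (σk : ∀ k, Ω k → Sk k → ℝ) (hσ : ∀ k, IsMech (σk k)) :
    ∃ ψk : ∀ k, Ω k → Bool → ℝ, (∀ k, IsMech (ψk k)) ∧
      ∃ fhat : (Fin K → Bool) → Option (Fin K) → ℝ, InFd fhat ∧
        IsOptimal (fun ω => ∏ k, μk k (ω k)) h
          (fun ω u => ∏ k, ψk k (ω k) (u k)) fhat ∧
        ∀ f : (∀ k, Sk k) → Option (Fin K) → ℝ, IsStrat K f →
          IsOptimal (fun ω => ∏ k, μk k (ω k)) h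
            (fun ω s => ∏ k, σk k (ω k) (s k)) f →
          T (fun ω => ∏ k, μk k (ω k)) (fun ω s => ∏ k, σk k (ω k) (s k)) f ≤
            T (fun ω => ∏ k, μk k (ω k)) (fun ω u => ∏ k, ψk k (ω k) (u k)) fhat := by
  classical
  set p : ∀ k, Sk k → ℝ := fun k => sP (μk k) (σk k) with hp
  set m : ∀ k, Sk k → ℝ := fun k => sM (μk k) (h k) (σk k) with hm
  set ψ : ∀ k, Ω k → Bool → ℝ := fun k x b =>
    ∑ s, if decide (0 ≤ m k s) = b then σk k x s else 0 with hψ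
  have hψM : ∀ k, IsMech (ψ k) := by
    intro k
    refine ⟨fun x b => sum_nonneg fun s _ => ?_, fun x => ?_⟩
    · split_ifs
      · exact (hσ k).1 x s
      · exact le_rfl
    · simp only [hψ]
      rw [sum_comm]
      simp only [sum_ite_eq, mem_univ, if_true]
      exact (hσ k).2 x
  have hP : ∀ k b, sP (μk k) (ψ k) b = ∑ s, if decide (0 ≤ m k s) = b then p k s else 0 := by
    intro k b
    simp only [sP, hψ, hp, mul_sum]
    rw [sum_comm]
    apply sum_congr rfl
    intro s _
    split_ifs <;> simp
  have hM : ∀ k b, sM (μk k) (h k) (ψ k) b =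
      ∑ s, if decide (0 ≤ m k s) = b then m k s else 0 := by
    intro k b
    have : ∀ s, (if decide (0 ≤ m k s) = b then m k s else 0) =
      ∑ x, μk k x * (if decide (0 ≤ m k s) = b then σk k x s else 0) * h k x := by
      intro s
      split_ifs
      · rfl
      · simp
    simp_rw [this]
    rw [sum_comm]
    simp only [sM, hψ, mul_sum, sum_mul]
  have hMt : ∀ k, 0 ≤ sM (μk k) (h k) (ψ k) true := by
    intro k
    rw [hM]
    refine sum_nonneg fun s _ => ?_
    split_ifs with hh
    · simpa using hh
    · exact le_rfl
  have hMf : ∀ k, sM (μk k) (h k) (ψ k) false ≤ 0 := by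
    intro k
    rw [hM]
    refine sum_nonpos fun s _ => ?_
    split_ifs with hh
    · have : m k s < 0 := by simpa using hh
      exact this.le
    · exact le_rfl
  have hc : ∀ u : Fin K → Bool, ∃ a : Option (Fin K),
      (u = (fun _ => false) → a = none) ∧ (u ≠ (fun _ => false) → ∃ k, a = some k ∧
        u k = true ∧ ∀ j, u j = true →
          sM (μk j) (h j) (ψ j) true / sP (μk j) (ψ j) true ≤
          sM (μk k) (h k) (ψ k) true / sP (μk k) (ψ k) true) := by
    intro u
    by_cases hu : u = fun _ => false
    · exact ⟨none, fun _ => rfl, fun hh => absurd hu hh⟩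
    · obtain ⟨i, hi⟩ : ∃ i, u i = true := by
        by_contra hcon
        push Not at hcon
        exact hu (funext fun i => by simpa using hcon i)
      obtain ⟨k, hk, hmax⟩ := exists_max_image (univ.filter fun j => u j = true)
        (fun j => sM (μk j) (h j) (ψ j) true / sP (μk j) (ψ j) true) ⟨i, by simp [hi]⟩
      exact ⟨some k, fun hh => absurd hh hu, fun _ => ⟨k, rfl, by simpa using hk,
        fun j hj => hmax j (by simp [hj])⟩⟩
  choose c hc0 hc1 using hc
  have hfS : IsStrat K (fun u a => if a = c u then (1 : ℝ) else 0) := by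
    refine ⟨fun u a => ?_, fun u => by simp⟩
    dsimp only
    split_ifs <;> norm_num
  refine ⟨ψ, hψM, fun u a => if a = c u then 1 else 0, ⟨hfS, ?_, ?_⟩, ?_, ?_⟩
  · intro u hu
    obtain ⟨k, hk, -⟩ := hc1 u hu
    simp [hk]
  · intro u k hk
    by_cases hu : u = fun _ => false
    · simp [hc0 u hu]
    · obtain ⟨i, hi, hi2, -⟩ := hc1 u hu
      have : k ≠ i := by rintro rfl; simp [hk] at hi2
      simp [hi, this]
  · intro u hu a ha a'
    have ha : a = c u := by
      by_contra hne
      simp [hne] at ha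
    subst ha
    rw [fact1] at hu
    have hpos : ∀ j, 0 < sP (μk j) (ψ j) (u j) := by
      intro j
      refine lt_of_le_of_ne (sP_nonneg (hμ j) (hψM j) _) fun h0 => ?_
      exact hu.ne' (prod_eq_zero (mem_univ j) h0.symm)
    have hval : ∀ j, ∑ ω : (∀ k, Ω k), (∏ k, μk k (ω k)) * (∏ k, ψ k (ω k) (u k)) *
        util h ω (some j) = sM (μk j) (h j) (ψ j) (u j) / sP (μk j) (ψ j) (u j) *
          ∏ k, sP (μk k) (ψ k) (u k) := by
      intro j
      have := fact2 μk h ψ u j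
      simp only [util]
      rw [this, ← mul_prod_erase univ (fun k => sP (μk k) (ψ k) (u k)) (mem_univ j)]
      have := (hpos j).ne'
      field_simp
    have hnone : ∑ ω : (∀ k, Ω k), (∏ k, μk k (ω k)) * (∏ k, ψ k (ω k) (u k)) *
        util h ω none = 0 := by simp [util]
    have hfalse : ∀ j, u j = false → sM (μk j) (h j) (ψ j) (u j) / sP (μk j) (ψ j) (u j) *
          ∏ k, sP (μk k) (ψ k) (u k) ≤ 0 := by
      intro j hj
      refine mul_nonpos_of_nonpos_of_nonneg (div_nonpos_of_nonpos_of_nonneg ?_ (hpos j).le) hu.le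
      rw [hj]; exact hMf j
    by_cases h0 : u = fun _ => false
    · rw [hc0 u h0, hnone]
      cases a' with
      | none => rw [hnone]
      | some j => rw [hval]; exact hfalse j (by rw [h0])
    · obtain ⟨k, hk, hk2, hmax⟩ := hc1 u h0
      rw [hk, hval k]
      have hk0 : 0 ≤ sM (μk k) (h k) (ψ k) (u k) / sP (μk k) (ψ k) (u k) *
          ∏ k, sP (μk k) (ψ k) (u k) := by
        refine mul_nonneg (div_nonneg ?_ (hpos k).le) hu.le
        rw [hk2]; exact hMt k
      cases a' with
      | none => rw [hnone]; exact hk0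
      | some j =>
        rw [hval j]
        rcases hj : u j with _ | _
        · rw [← hj]; exact (hfalse j hj).trans hk0
        · refine mul_le_mul_of_nonneg_right ?_ hu.le
          rw [hk2]
          exact hmax j hj
  · intro f hf hopt
    rw [T_eq μk hμ σk hσ f hf, T_eq μk hμ ψ hψM _ hfS]
    refine sub_le_sub_left ?_ 1
    have e1 : ∑ u : Fin K → Bool, (∏ k, sP (μk k) (ψ k) (u k)) *
        (if none = c u then (1 : ℝ) else 0) = ∏ k, sP (μk k) (ψ k) false := by
      rw [sum_eq_single (fun _ => false)]
      · simp [hc0 (fun _ => false) rfl]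
      · intro u _ hu
        obtain ⟨k, hk, -⟩ := hc1 u hu
        simp [hk]
      · simp
    rw [e1]
    simp_rw [hP]
    rw [← sum_pi_prod (fun k s => if decide (0 ≤ m k s) = false then p k s else 0)]
    refine sum_le_sum fun s _ => ?_
    have hp0 : ∀ k, 0 ≤ p k (s k) := fun k => sP_nonneg (hμ k) (hσ k) _
    by_cases hneg : ∀ k, m k (s k) < 0
    · have e2 : ∏ k, (if decide (0 ≤ m k (s k)) = false then p k (s k) else 0) =
          ∏ k, p k (s k) := prod_congr rfl fun k _ => by simp [hneg k]
      rw [e2]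
      rcases (prod_nonneg fun k _ => hp0 k : 0 ≤ ∏ k, p k (s k)).eq_or_lt with hz | hz
      · change _ ≤ (∏ k, p k (s k)) * _
        rw [← hz]; simp
      · have hfn : f s none = 1 := by
          have h1 := hf.2 s
          rw [Fintype.sum_option] at h1
          have h2 : ∑ k, f s (some k) = 0 := by
            refine sum_eq_zero fun k _ => ?_
            by_contra hne
            have hlt := lt_of_le_of_ne (hf.1 s (some k)) (Ne.symm hne)
            have h3 := hopt s (by rw [fact1]; exact hz) (some k) hlt none
            simp only [util] at h3
            rw [fact2 μk h σk s k] at h3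
            simp only [mul_zero, sum_const_zero] at h3
            have h4 : 0 < ∏ j ∈ univ.erase k, p j (s j) := by
              refine prod_pos fun j _ => lt_of_le_of_ne (hp0 j) fun h0 => ?_
              exact hz.ne' (prod_eq_zero (mem_univ j) h0.symm)
            exact absurd h3 (not_le.2 (mul_neg_of_neg_of_pos (hneg k) h4))
          linarith
        rw [hfn, mul_one]
    · push Not at hneg
      obtain ⟨k, hk⟩ := hneg
      rw [prod_eq_zero (mem_univ k) (by simp [hk])]
      exact mul_nonneg (prod_nonneg fun k _ => hp0 k) (hf.1 s none)
end

section
/- Suppose the locations are independent, and let σ be a decentralized signaling mechanism with signal set U = {0,1}^K given by components σ_1, …, σ_K. Then there exists a strategy f ∈ F_d that is optimal under σ if and only if at least one of the following two conditions holds. Condition (I): there exists a location k ∈ {1,…,K} such that (a) μ_k(ω_k)σ_k(0|ω_k) = 0 for all ω_k ∈ Ω_k; (b) ∑_{ω_k∈Ω_k} μ_k(ω_k)h_k(ω_k) ≥ 0; and (c) for every ℓ ∈ {1,…,K} with ℓ ≠ k, (∑_{ω_ℓ∈Ω_ℓ} μ_ℓ(ω_ℓ)σ_ℓ(0|ω_ℓ))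 · (∑_{ω_k∈Ω_k} μ_k(ω_k)h_k(ω_k)) ≥ ∑_{ω_ℓ∈Ω_ℓ} μ_ℓ(ω_ℓ)σ_ℓ(0|ω_ℓ)h_ℓ(ω_ℓ). Condition (II): for every k ∈ {1,…,K}, ∑_{ω_k∈Ω_k} μ_k(ω_k)σ_k(1|ω_k)h_k(ω_k) ≥ 0 and ∑_{ω_k∈Ω_k} μ_k(ω_k)σ_k(0|ω_k)h_k(ω_k) ≤ 0. -/
namespace Stmt4Aux

open Finset

variable {K : ℕ} {Ω : Fin K → Type} [∀ k, Fintype (Ω k)]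

/-- Probability of the signal `b` at location `k`. -/
noncomputable def pr (μk : ∀ k, Ω k → ℝ) (σk : ∀ k, Ω k → Bool → ℝ) (k : Fin K) (b : Bool) : ℝ :=
  ∑ x, μk k x * σk k x b

/-- Unnormalized utility of location `k` given the signal `b`. -/
noncomputable def hh (μk : ∀ k, Ω k → ℝ) (h : ∀ k, Ω k → ℝ) (σk : ∀ k, Ω k → Bool → ℝ)
    (k : Fin K) (b : Bool) : ℝ :=
  ∑ x, μk k x * σk k x b * h k x

/-- Posterior mean utility of an action. -/
noncomputable def val (μk : ∀ k, Ω k → ℝ) (h : ∀ k, Ω k → ℝ) (σk : ∀ k, Ω k → Bool → ℝ)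
    (u : Fin K → Bool) : Option (Fin K) → ℝ
  | none => 0
  | some k => hh μk h σk k (u k) / pr μk σk k (u k)

theorem sum_P (μk : ∀ k, Ω k → ℝ) (σk : ∀ k, Ω k → Bool → ℝ) (u : Fin K → Bool) :
    ∑ ω : (∀ k, Ω k), (∏ k, μk k (ω k)) * (∏ k, σk k (ω k) (u k)) = ∏ k, pr μk σk k (u k) := by
  classical
  simp only [pr, ← prod_mul_distrib]
  rw [Finset.prod_univ_sum, Fintype.piFinset_univ]

theorem sum_U (μk : ∀ k, Ω k → ℝ) (h : ∀ k, Ω k → ℝ) (σk : ∀ k, Ω k → Bool → ℝ)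
    (u : Fin K → Bool) (hp : ∀ k, pr μk σk k (u k) ≠ 0) (a : Option (Fin K)) :
    ∑ ω : (∀ k, Ω k), (∏ k, μk k (ω k)) * (∏ k, σk k (ω k) (u k)) * util h ω a
      = (∏ k, pr μk σk k (u k)) * val μk h σk u a := by
  classical
  cases a with
  | none => simp [util, val]
  | some i =>
    have e1 : ∀ ω : (∀ k, Ω k), (∏ k, μk k (ω k)) * (∏ k, σk k (ω k) (u k)) * util h ω (some i)
        = ∏ k, (μk k (ω k) * σk k (ω k) (u k) * (if k = i then h k (ω k) else 1)) := by
      intro ω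
      rw [prod_mul_distrib, prod_mul_distrib]
      simp [util]
    have e2 : ∀ k, ∑ x, (μk k x * σk k x (u k) * (if k = i then h k x else 1))
        = pr μk σk k (u k) * (if k = i then hh μk h σk k (u k) / pr μk σk k (u k) else 1) := by
      intro k
      by_cases hk : k = i
      · subst hk
        simp only [if_true]
        rw [mul_div_cancel₀ _ (hp k)]
        rfl
      · simp [hk, pr]
    simp only [e1]
    have e3 := Finset.prod_univ_sum (fun k => (univ : Finset (Ω k)))
      (fun k x => μk k x * σk k x (u k) * (if k = i then h k x else 1))
    rw [Fintype.piFinset_univ] at e3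
    rw [← e3]
    simp only [e2]
    rw [prod_mul_distrib]
    simp [val]

theorem pr_nonneg (μk : ∀ k, Ω k → ℝ) (hμ : ∀ k, IsDist (μk k))
    (σk : ∀ k, Ω k → Bool → ℝ) (hσ : ∀ k, IsMech (σk k)) (k : Fin K) (b : Bool) :
    0 ≤ pr μk σk k b :=
  sum_nonneg fun x _ => mul_nonneg ((hμ k).1 x) ((hσ k).1 x b)

theorem term_zero (μk : ∀ k, Ω k → ℝ) (hμ : ∀ k, IsDist (μk k))
    (σk : ∀ k, Ω k → Bool → ℝ) (hσ : ∀ k, IsMech (σk k)) (k : Fin K) (b : Bool)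
    (h0 : pr μk σk k b = 0) (x : Ω k) : μk k x * σk k x b = 0 :=
  (sum_eq_zero_iff_of_nonneg
    (fun x _ => mul_nonneg ((hμ k).1 x) ((hσ k).1 x b))).1 h0 x (mem_univ x)

theorem hh_zero (μk : ∀ k, Ω k → ℝ) (hμ : ∀ k, IsDist (μk k)) (h : ∀ k, Ω k → ℝ)
    (σk : ∀ k, Ω k → Bool → ℝ) (hσ : ∀ k, IsMech (σk k)) (k : Fin K) (b : Bool)
    (h0 : pr μk σk k b = 0) : hh μk h σk k b = 0 :=
  sum_eq_zero fun x _ => by rw [term_zero μk hμ σk hσ k b h0 x, zero_mul]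

theorem pr_add (μk : ∀ k, Ω k → ℝ) (hμ : ∀ k, IsDist (μk k))
    (σk : ∀ k, Ω k → Bool → ℝ) (hσ : ∀ k, IsMech (σk k)) (k : Fin K) :
    pr μk σk k true + pr μk σk k false = 1 := by
  unfold pr
  rw [← sum_add_distrib, ← (hμ k).2]
  refine sum_congr rfl fun x _ => ?_
  have := (hσ k).2 x
  rw [Fintype.sum_bool] at this
  rw [← mul_add, this, mul_one]

theorem hh_add (μk : ∀ k, Ω k → ℝ) (h : ∀ k, Ω k → ℝ)
    (σk : ∀ k, Ω k → Bool → ℝ) (hσ : ∀ k, IsMech (σk k)) (k : Fin K) :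
    hh μk h σk k true + hh μk h σk k false = ∑ x, μk k x * h k x := by
  unfold hh
  rw [← sum_add_distrib]
  refine sum_congr rfl fun x _ => ?_
  have := (hσ k).2 x
  rw [Fintype.sum_bool] at this
  rw [← add_mul, ← mul_add, this, mul_one]

theorem optimal_iff (μk : ∀ k, Ω k → ℝ) (hμ : ∀ k, IsDist (μk k)) (h : ∀ k, Ω k → ℝ)
    (σk : ∀ k, Ω k → Bool → ℝ) (hσ : ∀ k, IsMech (σk k))
    (f : (Fin K → Bool) → Option (Fin K) → ℝ) :
    IsOptimal (fun ω => ∏ k, μk k (ω k)) h (fun ω u => ∏ k, σk k (ω k) (u k)) f ↔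
    ∀ u : Fin K → Bool, (∀ k, 0 < pr μk σk k (u k)) → ∀ a, 0 < f u a → ∀ a',
      val μk h σk u a' ≤ val μk h σk u a := by
  unfold IsOptimal
  refine forall_congr' fun u => ?_
  rw [sum_P]
  have hpos : (0 < ∏ k, pr μk σk k (u k)) ↔ ∀ k, 0 < pr μk σk k (u k) := by
    constructor
    · intro hP k
      refine lt_of_le_of_ne (pr_nonneg μk hμ σk hσ k _) fun h0 => ?_
      exact hP.ne' (prod_eq_zero (mem_univ k) h0.symm)
    · exact fun hp => prod_pos fun k _ => hp k
  rw [hpos]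
  refine forall_congr' fun hp => ?_
  have hP := hpos.2 hp
  simp only [sum_U μk h σk u (fun k => (hp k).ne'), mul_le_mul_iff_right₀ hP]

theorem exists_action {S : Type*} (f : S → Option (Fin K) → ℝ)
    (h1 : ∀ s, ∑ a, f s a = 1) (h0 : ∀ s a, 0 ≤ f s a) (s : S) : ∃ a, 0 < f s a := by
  by_contra! hc
  have : ∑ a, f s a ≤ 0 := sum_nonpos fun a _ => hc a
  rw [h1] at this
  linarith

/-- Pure selection of actions gives a strategy. -/
theorem of_actions (μk : ∀ k, Ω k → ℝ) (h : ∀ k, Ω k → ℝ) (σk : ∀ k, Ω k → Bool → ℝ)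
    (H : ∀ u : Fin K → Bool, ∃ a : Option (Fin K), (u ≠ (fun _ => false) → a ≠ none) ∧
      (∀ k, u k = false → a ≠ some k) ∧
      ((∀ k, 0 < pr μk σk k (u k)) → ∀ a', val μk h σk u a' ≤ val μk h σk u a)) :
    ∃ f : (Fin K → Bool) → Option (Fin K) → ℝ, InFd f ∧
      ∀ u : Fin K → Bool, (∀ k, 0 < pr μk σk k (u k)) → ∀ a, 0 < f u a → ∀ a',
      val μk h σk u a' ≤ val μk h σk u a := by
  classical
  choose A h1 h2 h3 using H
  refine ⟨fun u a => if A u = a then 1 else 0, ⟨⟨?_, ?_⟩, ?_, ?_⟩, ?_⟩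
  · intro u a
    dsimp only
    split_ifs <;> norm_num
  · intro u
    simp
  · intro u hu
    simp [h1 u hu]
  · intro u k hk
    simp [h2 u k hk]
  · intro u hp a ha
    by_cases e : A u = a
    · subst e
      exact h3 u hp
    · simp [e] at ha

theorem exists_max (r : Fin K → ℝ) (u : Fin K → Bool) (hu : u ≠ (fun _ => false)) :
    ∃ k, u k = true ∧ ∀ l, u l = true → r l ≤ r k := by
  have hne : (univ.filter fun k => u k = true).Nonempty := by
    by_contra hc
    apply hu
    funext k
    by_contra hk
    apply hc
    exact ⟨k, by simpa using hk⟩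
  obtain ⟨k, hk, hm⟩ := exists_max_image _ r hne
  exact ⟨k, by simpa using hk, fun l hl => hm l (by simpa using hl)⟩

theorem core (μk : ∀ k, Ω k → ℝ) (hμ : ∀ k, IsDist (μk k)) (h : ∀ k, Ω k → ℝ)
    (σk : ∀ k, Ω k → Bool → ℝ) (hσ : ∀ k, IsMech (σk k)) :
    (∃ f : (Fin K → Bool) → Option (Fin K) → ℝ, InFd f ∧
        IsOptimal (fun ω => ∏ k, μk k (ω k)) h
          (fun ω u => ∏ k, σk k (ω k) (u k)) f) ↔
      ((∃ k : Fin K, pr μk σk k false = 0 ∧ 0 ≤ (∑ x, μk k x * h k x) ∧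
          ∀ l : Fin K, l ≠ k →
            hh μk h σk l false ≤ pr μk σk l false * ∑ x, μk k x * h k x) ∨
        (∀ k : Fin K, 0 ≤ hh μk h σk k true ∧ hh μk h σk k false ≤ 0)) := by
  classical
  simp only [optimal_iff μk hμ h σk hσ]
  have hnn := pr_nonneg μk hμ σk hσ
  have hadd := pr_add μk hμ σk hσ
  have hz := hh_zero μk hμ h σk hσ
  have hE : ∀ k, pr μk σk k false = 0 →
      hh μk h σk k true / pr μk σk k true = ∑ x, μk k x * h k x := by
    intro k hk
    have e1 := hadd k
    have e2 := hh_add μk h σk hσ k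
    rw [hk, add_zero] at e1
    rw [hz k _ hk, add_zero] at e2
    rw [e1, e2, div_one]
  constructor
  · rintro ⟨f, ⟨⟨hf0, hf1⟩, hfn, hfk⟩, hopt⟩
    by_cases hall : ∀ k, 0 < pr μk σk k false
    · right
      intro k
      constructor
      · rcases (hnn k true).eq_or_lt with h0 | hpos
        · rw [hz k true h0.symm]
        · have hp : ∀ j, 0 < pr μk σk j ((fun j => decide (j = k)) j) := by
            intro j
            by_cases hj : j = k
            · subst hj; simpa using hpos
            · simpa [hj] using hall j
          obtain ⟨a, ha⟩ := exists_action f hf1 hf0 (fun j => decide (j = k))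
          have hak : a = some k := by
            cases a with
            | none =>
              rw [hfn _ (fun hc => by simpa using congrFun hc k)] at ha
              exact absurd ha (lt_irrefl _)
            | some i =>
              by_contra hne
              have hik : i ≠ k := fun e => hne (by rw [e])
              rw [hfk _ i (by simpa using hik)] at ha
              exact absurd ha (lt_irrefl _)
          subst hak
          have := hopt _ hp _ ha none
          simp only [val, decide_true] at this
          have h2 := mul_nonneg this hpos.le
          rwa [div_mul_cancel₀ _ hpos.ne'] at h2
      · obtain ⟨a, ha⟩ := exists_action f hf1 hf0 (fun _ => false)
        have han : a = none := by
          cases a with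
          | none => rfl
          | some i =>
            rw [hfk _ i rfl] at ha
            exact absurd ha (lt_irrefl _)
        subst han
        have := hopt _ hall _ ha (some k)
        simp only [val] at this
        rwa [div_le_iff₀ (hall k), zero_mul] at this
    · left
      push Not at hall
      obtain ⟨z, hz0⟩ := hall
      have hz0 : pr μk σk z false = 0 := le_antisymm hz0 (hnn z false)
      have hp : ∀ j, 0 < pr μk σk j ((fun j => decide (pr μk σk j false = 0)) j) := by
        intro j
        by_cases hj : pr μk σk j false = 0
        · have := hadd j
          simp only [hj, decide_true]
          linarith
        · simp only [hj, decide_false]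
          exact lt_of_le_of_ne (hnn j false) (Ne.symm hj)
      obtain ⟨a, ha⟩ := exists_action f hf1 hf0 (fun j => decide (pr μk σk j false = 0))
      cases a with
      | none =>
        rw [hfn _ (fun hc => by simpa [hz0] using congrFun hc z)] at ha
        exact absurd ha (lt_irrefl _)
      | some k =>
        have hk : pr μk σk k false = 0 := by
          by_contra hne
          rw [hfk _ k (by simpa using hne)] at ha
          exact absurd ha (lt_irrefl _)
        have ho := hopt _ hp _ ha
        refine ⟨k, hk, ?_, ?_⟩
        · have := ho none
          simp only [val, hk, decide_true, hE k hk] at this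
          exact this
        · intro l _
          by_cases hl : pr μk σk l false = 0
          · rw [hz l _ hl, hl, zero_mul]
          · have := ho (some l)
            simp only [val, hk, hl, decide_true, decide_false, hE k hk] at this
            rwa [div_le_iff₀ (lt_of_le_of_ne (hnn l false) (Ne.symm hl)), mul_comm] at this
  · intro hc
    apply of_actions
    intro u
    by_cases hu : u = fun _ => false
    · subst hu
      refine ⟨none, fun h => absurd rfl h, fun _ _ => by simp, fun hp => ?_⟩
      rcases hc with ⟨k, hk, _⟩ | hc
      · exact absurd hk (hp k).ne'
      · rintro (_ | l)
        · exact le_rfl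
        · exact div_nonpos_of_nonpos_of_nonneg (hc l).2 (hnn l false)
    · obtain ⟨m, hm, hmax⟩ := exists_max
        (fun k => hh μk h σk k true / pr μk σk k true) u hu
      refine ⟨some m, fun _ => by simp, ?_, fun hp => ?_⟩
      · rintro k hk he
        obtain rfl := Option.some.inj he
        rw [hm] at hk
        cases hk
      · rcases hc with ⟨k, hk, hk0, hkl⟩ | hc
        · have huk : u k = true := by
            by_contra hne
            have hne : u k = false := by simpa using hne
            have := hp k
            rw [hne, hk] at this
            exact lt_irrefl _ this
          have hkm := hmax k huk
          simp only [hE k hk] at hkm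
          rintro (_ | l)
          · simp only [val, hm]
            linarith
          · simp only [val, hm]
            cases hl : u l with
            | true => exact hmax l hl
            | false =>
              have hpl := hp l
              rw [hl] at hpl
              refine le_trans ?_ hkm
              rw [div_le_iff₀ hpl, mul_comm]
              refine hkl l fun e => ?_
              rw [e, huk] at hl
              cases hl
        · have hm0 : 0 ≤ hh μk h σk m true / pr μk σk m true := div_nonneg (hc m).1 (hnn m true)
          rintro (_ | l)
          · simpa only [val, hm] using hm0
          · simp only [val, hm]
            cases hl : u l with
            | true => exact hmax l hl
            | false => exact (div_nonpos_of_nonpos_of_nonneg (hc l).2 (hnn l false)).trans hm0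

end Stmt4Aux

open Finset in
/-- Lemma 2. For independent locations and a decentralized mechanism `σ`
with binary signals, there exists `f ∈ F_d` optimal under `σ` iff condition (I) or
condition (II) holds. -/
theorem stmt4 {K : ℕ} (hK : 1 ≤ K) {Ω : Fin K → Type} [∀ k, Fintype (Ω k)]
    [∀ k, Nonempty (Ω k)]
    (μk : ∀ k, Ω k → ℝ) (hμ : ∀ k, IsDist (μk k))
    (h : ∀ k, Ω k → ℝ)
    (σk : ∀ k, Ω k → Bool → ℝ) (hσ : ∀ k, IsMech (σk k)) :
    (∃ f : (Fin K → Bool) → Option (Fin K) → ℝ, InFd f ∧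
        IsOptimal (fun ω => ∏ k, μk k (ω k)) h
          (fun ω u => ∏ k, σk k (ω k) (u k)) f) ↔
      ((∃ k : Fin K,
          (∀ ωk : Ω k, μk k ωk * σk k ωk false = 0) ∧
          0 ≤ (∑ ωk, μk k ωk * h k ωk) ∧
          ∀ l : Fin K, l ≠ k →
            (∑ ωl, μk l ωl * σk l ωl false * h l ωl) ≤
              (∑ ωl, μk l ωl * σk l ωl false) * ∑ ωk, μk k ωk * h k ωk) ∨
        (∀ k : Fin K,
          0 ≤ (∑ ωk, μk k ωk * σk k ωk true * h k ωk) ∧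
          (∑ ωk, μk k ωk * σk k ωk false * h k ωk) ≤ 0)) := by
  rw [Stmt4Aux.core μk hμ h σk hσ]
  refine or_congr (exists_congr fun k => and_congr ?_ Iff.rfl) Iff.rfl
  exact ⟨Stmt4Aux.term_zero μk hμ σk hσ k false, fun hx => Finset.sum_eq_zero fun x _ => hx x⟩
end

section
/- Suppose the locations are independent. For each k ∈ {1,…,K}, let σ_k : Ω_k × {0,1} → [0,1] be an optimal solution of the isolated linear program for (μ_k, h_k), with optimal value Th_k^iso, and define the decentralized mechanism σ on U = {0,1}^K by σ(u|ω) = ∏_{k=1}^K σ_k(u_k|ω_k). Then: (1) there exists a strategy f ∈ F_d that is optimal under σ, and T(σ, f) = 1 − ∏_{k=1}^K (1 − Th_k^iso); and (2) for any finite nonempty sets S_1, …, S_K, any decentralized signaling mechanism σ' with signal set S = S_1 × ⋯ × S_K, and any strategy f' on S that is optimal under σ', one has T(σ', f') ≤ 1 − ∏_{k=1}^K (1 − Th_k^iso). -/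
namespace Aux
open Finset

/-- marginal probability of a signal -/
noncomputable def p {α S : Type} [Fintype α] (ν : α → ℝ) (σ : α → S → ℝ) (s : S) : ℝ :=
  ∑ a, ν a * σ a s

/-- unnormalized expected utility given a signal -/
noncomputable def m {α S : Type} [Fintype α] (ν h : α → ℝ) (σ : α → S → ℝ) (s : S) : ℝ :=
  ∑ a, ν a * σ a s * h a

lemma sum_pi {K : ℕ} {Ω : Fin K → Type} [∀ k, Fintype (Ω k)] (F : ∀ k, Ω k → ℝ) :
    ∑ ω : ∀ k, Ω k, ∏ k, F k (ω k) = ∏ k, ∑ a, F k a := by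
  classical
  rw [Finset.prod_univ_sum, Fintype.piFinset_univ]

lemma p_nonneg {α S : Type} [Fintype α] [Fintype S] {ν : α → ℝ} (hν : IsDist ν)
    {σ : α → S → ℝ} (hσ : IsMech σ) (s : S) : 0 ≤ p ν σ s :=
  Finset.sum_nonneg fun a _ => mul_nonneg (hν.1 a) (hσ.1 a s)

lemma p_sum {α S : Type} [Fintype α] [Fintype S] {ν : α → ℝ} (hν : IsDist ν)
    {σ : α → S → ℝ} (hσ : IsMech σ) : ∑ s, p ν σ s = 1 := by
  unfold p
  rw [Finset.sum_comm]
  simp_rw [← Finset.mul_sum, hσ.2, mul_one]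
  exact hν.2

section
variable {K : ℕ} {Ω : Fin K → Type} [∀ k, Fintype (Ω k)]
  (μk : ∀ k, Ω k → ℝ) (h : ∀ k, Ω k → ℝ) {Sk : Fin K → Type} [∀ k, Fintype (Sk k)]
  (σk : ∀ k, Ω k → Sk k → ℝ)

lemma prob (s : ∀ k, Sk k) :
    ∑ ω : ∀ k, Ω k, (∏ k, μk k (ω k)) * (∏ k, σk k (ω k) (s k)) =
      ∏ k, p (μk k) (σk k) (s k) := by
  simp_rw [← Finset.prod_mul_distrib]
  exact sum_pi (fun k a => μk k a * σk k a (s k))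

lemma eu (s : ∀ k, Sk k) (k : Fin K) :
    ∑ ω : ∀ k, Ω k, (∏ k, μk k (ω k)) * (∏ k, σk k (ω k) (s k)) * util h ω (some k) =
      m (μk k) (h k) (σk k) (s k) * ∏ j ∈ univ.erase k, p (μk j) (σk j) (s j) := by
  have h1 := sum_pi (fun j a => μk j a * σk j a (s j) * if j = k then h j a else 1)
  simp only [Finset.prod_mul_distrib, Finset.prod_ite_eq', Finset.mem_univ, if_true] at h1
  unfold util
  rw [h1, ← Finset.mul_prod_erase _ _ (Finset.mem_univ k)]
  congr 1
  · simp [m]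
  · refine Finset.prod_congr rfl fun j hj => ?_
    simp [p, Finset.ne_of_mem_erase hj]

lemma eu_none (s : ∀ k, Sk k) :
    ∑ ω : ∀ k, Ω k, (∏ k, μk k (ω k)) * (∏ k, σk k (ω k) (s k)) * util h ω none = 0 := by
  simp [util]

lemma T_eq (f : (∀ k, Sk k) → Option (Fin K) → ℝ) (hf : IsStrat K f) :
    T (fun ω => ∏ k, μk k (ω k)) (fun ω s => ∏ k, σk k (ω k) (s k)) f =
      ∑ s : ∀ k, Sk k, (∏ k, p (μk k) (σk k) (s k)) * (1 - f s none) := by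
  unfold T
  rw [Finset.sum_comm]
  refine Finset.sum_congr rfl fun s _ => ?_
  simp_rw [← Finset.mul_sum]
  rw [← Finset.sum_mul, prob]
  congr 1
  have := hf.2 s
  rw [Fintype.sum_option] at this
  linarith

end

section
variable {K : ℕ} {Ω : Fin K → Type} [∀ k, Fintype (Ω k)]

lemma part1 (μk : ∀ k, Ω k → ℝ) (hμ : ∀ k, IsDist (μk k))
    (h : ∀ k, Ω k → ℝ)
    (σk : ∀ k, Ω k → Bool → ℝ) (hσ : ∀ k, IsMech (σk k))
    (hfeas : ∀ k, IsoFeas (μk k) (h k) (fun ωk => σk k ωk true)) : ∃ f : (Fin K → Bool) → Option (Fin K) → ℝ, InFd f ∧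
        IsOptimal (fun ω => ∏ k, μk k (ω k)) h
          (fun ω u => ∏ k, σk k (ω k) (u k)) f ∧
        T (fun ω => ∏ k, μk k (ω k)) (fun ω u => ∏ k, σk k (ω k) (u k)) f =
          1 - ∏ k, (1 - ∑ ωk, μk k ωk * σk k ωk true) := by
  classical
  have hfalse : ∀ k a, σk k a false = 1 - σk k a true := by
    intro k a
    have := (hσ k).2 a
    simp at this
    linarith
  have hm1 : ∀ k, 0 ≤ m (μk k) (h k) (σk k) true := fun k => (hfeas k).2.2.1
  have hm0 : ∀ k, m (μk k) (h k) (σk k) false ≤ 0 := by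
    intro k
    have := (hfeas k).2.2.2
    simpa [m, hfalse] using this
  have hp0 : ∀ k, p (μk k) (σk k) false = 1 - ∑ ωk, μk k ωk * σk k ωk true := by
    intro k
    have := p_sum (hμ k) (hσ k)
    simp [p] at this ⊢
    linarith
  let E : (Fin K → Bool) → Fin K → ℝ := fun u k =>
    m (μk k) (h k) (σk k) (u k) * ∏ j ∈ univ.erase k, p (μk j) (σk j) (u j)
  have hq : ∀ (u : Fin K → Bool) k, 0 ≤ ∏ j ∈ univ.erase k, p (μk j) (σk j) (u j) :=
    fun u k => Finset.prod_nonneg fun j _ => p_nonneg (hμ j) (hσ j) _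
  have hE1 : ∀ u k, u k = true → 0 ≤ E u k := by
    intro u k hk
    refine mul_nonneg ?_ (hq u k)
    rw [hk]; exact hm1 k
  have hE0 : ∀ u k, u k = false → E u k ≤ 0 := by
    intro u k hk
    refine mul_nonpos_of_nonpos_of_nonneg ?_ (hq u k)
    rw [hk]; exact hm0 k
  have hc : ∀ u : Fin K → Bool, ∃ a : Option (Fin K),
      (u = (fun _ => false) → a = none) ∧
      (u ≠ (fun _ => false) → ∃ k, a = some k ∧ u k = true ∧
        ∀ j, u j = true → E u j ≤ E u k) := by
    intro u
    by_cases hu : u = fun _ => false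
    · exact ⟨none, fun _ => rfl, fun hh => absurd hu hh⟩
    · have hne : (univ.filter fun k => u k = true).Nonempty := by
        by_contra hcon
        apply hu
        funext k
        by_contra hk
        exact hcon ⟨k, by simpa using hk⟩
      obtain ⟨k, hk, hmax⟩ := Finset.exists_max_image _ (E u) hne
      refine ⟨some k, fun hh => absurd hh hu, fun _ => ⟨k, rfl, by simpa using hk, ?_⟩⟩
      intro j hj
      exact hmax j (by simpa using hj)
  choose c hc0 hc1 using hc
  let f : (Fin K → Bool) → Option (Fin K) → ℝ := fun u a => if a = c u then 1 else 0
  have hf : IsStrat K f := by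
    refine ⟨fun s a => ?_, fun s => ?_⟩
    · simp only [f]; split_ifs <;> norm_num
    · simp [f]
  refine ⟨f, ⟨hf, ?_, ?_⟩, ?_, ?_⟩
  · intro u hu
    obtain ⟨k, hk, -⟩ := hc1 u hu
    simp [f, hk]
  · intro u k hk
    by_cases hu : u = fun _ => false
    · simp [f, hc0 u hu]
    · obtain ⟨j, hj, hj1, -⟩ := hc1 u hu
      have : k ≠ j := by rintro rfl; simp [hk] at hj1
      simp [f, hj, this]
  · intro u _ a ha a'
    have hac : a = c u := by
      by_contra hcon
      simp [f, hcon] at ha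
    subst hac
    by_cases hu : u = fun _ => false
    · rw [hc0 u hu]
      rcases a' with _ | k
      · exact le_rfl
      · rw [eu μk h σk u k, eu_none]
        exact hE0 u k (by rw [hu])
    · obtain ⟨j, hj, hj1, hj2⟩ := hc1 u hu
      rw [hj, eu μk h σk u j]
      rcases a' with _ | k
      · rw [eu_none]; exact hE1 u j hj1
      · rw [eu μk h σk u k]
        by_cases hk : u k = true
        · exact hj2 k hk
        · exact (hE0 u k (by simpa using hk)).trans (hE1 u j hj1)
  · rw [T_eq μk σk f hf]
    have hn : ∀ u, f u none = if u = (fun _ => false) then 1 else 0 := by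
      intro u
      by_cases hu : u = fun _ => false
      · simp only [f, hc0 u hu, if_pos hu, if_true]
      · obtain ⟨j, hj, -⟩ := hc1 u hu
        simp [f, hj, hu]
    simp_rw [hn, mul_sub, mul_one, Finset.sum_sub_distrib, mul_ite, mul_one, mul_zero]
    rw [Finset.sum_ite_eq', sum_pi (fun k s => p (μk k) (σk k) s)]
    simp only [p_sum (hμ _) (hσ _), Finset.prod_const_one, Finset.mem_univ, if_true, hp0]

lemma part2 (μk : ∀ k, Ω k → ℝ) (hμ : ∀ k, IsDist (μk k))
    (h : ∀ k, Ω k → ℝ) (σk : ∀ k, Ω k → Bool → ℝ)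
    (hfeas : ∀ k, IsoFeas (μk k) (h k) (fun ωk => σk k ωk true))
    (hopt : ∀ k, ∀ g : Ω k → ℝ, IsoFeas (μk k) (h k) g →
      (∑ ωk, μk k ωk * g ωk) ≤ ∑ ωk, μk k ωk * σk k ωk true)
    (Sk : Fin K → Type) [∀ k, Fintype (Sk k)]
    (σk' : ∀ k, Ω k → Sk k → ℝ) (hσ' : ∀ k, IsMech (σk' k))
    (f : (∀ k, Sk k) → Option (Fin K) → ℝ) (hf : IsStrat K f)
    (ho : IsOptimal (fun ω => ∏ k, μk k (ω k)) h
            (fun ω s => ∏ k, σk' k (ω k) (s k)) f) :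
    T (fun ω => ∏ k, μk k (ω k)) (fun ω s => ∏ k, σk' k (ω k) (s k)) f ≤
            1 - ∏ k, (1 - ∑ ωk, μk k ωk * σk k ωk true) := by
  classical
  rw [T_eq μk σk' f hf]
  let b : ∀ k, Sk k → ℝ := fun k s => if m (μk k) (h k) (σk' k) s < 0 then 1 else 0
  have hpn : ∀ k s, 0 ≤ p (μk k) (σk' k) s := fun k s => p_nonneg (hμ k) (hσ' k) s
  have step1 : ∀ s : ∀ k, Sk k, (∏ k, p (μk k) (σk' k) (s k)) * (1 - f s none) ≤
      (∏ k, p (μk k) (σk' k) (s k)) - ∏ k, (p (μk k) (σk' k) (s k) * b k (s k)) := by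
    intro s
    have hP : 0 ≤ ∏ k, p (μk k) (σk' k) (s k) := Finset.prod_nonneg fun k _ => hpn k _
    by_cases hall : ∀ k, m (μk k) (h k) (σk' k) (s k) < 0
    · have hb : ∀ k, b k (s k) = 1 := fun k => by simp [b, hall k]
      simp only [hb, mul_one, sub_self]
      rcases hP.eq_or_lt with hz | hpos
      · rw [← hz]; simp
      · have hpk : ∀ k, 0 < p (μk k) (σk' k) (s k) := by
          intro k
          refine (hpn k _).lt_of_ne fun hz => hpos.ne' ?_
          exact Finset.prod_eq_zero (Finset.mem_univ k) hz.symm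
        have h0 : ∀ k, f s (some k) = 0 := by
          intro k
          by_contra hcon
          have hfp := (hf.1 s (some k)).lt_of_ne (Ne.symm hcon)
          have := ho s (by rw [prob μk σk' s]; exact hpos) _ hfp none
          rw [eu_none, eu μk h σk' s k] at this
          have h2 := mul_neg_of_neg_of_pos (hall k)
            (Finset.prod_pos (s := univ.erase k) fun j _ => hpk j)
          linarith
        have := hf.2 s
        rw [Fintype.sum_option] at this
        simp only [h0, Finset.sum_const_zero, add_zero] at this
        rw [this]; simp
    · push Not at hall
      obtain ⟨k, hk⟩ := hall
      have : ∏ k, (p (μk k) (σk' k) (s k) * b k (s k)) = 0 :=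
        Finset.prod_eq_zero (Finset.mem_univ k) (by simp [b, not_lt.mpr hk])
      rw [this]
      nlinarith [mul_nonneg hP (hf.1 s none)]
  refine (Finset.sum_le_sum fun s _ => step1 s).trans ?_
  rw [Finset.sum_sub_distrib, sum_pi (fun k s => p (μk k) (σk' k) s),
    sum_pi (fun k s => p (μk k) (σk' k) s * b k s)]
  simp only [p_sum (hμ _) (hσ' _), Finset.prod_const_one]
  refine sub_le_sub_left (Finset.prod_le_prod (fun k _ => ?_) (fun k _ => ?_)) 1
  · have : ∑ a, μk k a * σk k a true ≤ ∑ a, μk k a :=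
      Finset.sum_le_sum fun a _ => mul_le_of_le_one_right ((hμ k).1 a) ((hfeas k).2.1 a)
    rw [(hμ k).2] at this
    linarith
  · have hb01 : ∀ s, 0 ≤ b k s ∧ b k s ≤ 1 := by
      intro s; simp only [b]; split_ifs <;> norm_num
    have hsw : ∀ (w : Ω k → ℝ) (e : Sk k → ℝ), ∑ a, μk k a * (∑ s, σk' k a s * e s) * w a =
        ∑ s, (∑ a, μk k a * σk' k a s * w a) * e s := by
      intro w e
      simp_rw [Finset.mul_sum, Finset.sum_mul]
      rw [Finset.sum_comm]
      refine Finset.sum_congr rfl fun s _ => Finset.sum_congr rfl fun a _ => ?_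
      ring
    have h1g : ∀ a, 1 - ∑ s, σk' k a s * (1 - b k s) = ∑ s, σk' k a s * b k s := by
      intro a
      simp_rw [mul_sub, mul_one, Finset.sum_sub_distrib, (hσ' k).2]
      ring
    have hg := hopt k (fun a => ∑ s, σk' k a s * (1 - b k s)) ⟨?_, ?_, ?_, ?_⟩
    · have h2 := hsw (fun _ => 1) (fun s => b k s)
      simp only [mul_one] at h2
      have h3 : ∑ s, p (μk k) (σk' k) s * b k s =
          1 - ∑ a, μk k a * ∑ s, σk' k a s * (1 - b k s) := by
        unfold p
        rw [← h2]
        simp_rw [← h1g, mul_sub, mul_one, Finset.sum_sub_distrib, (hμ k).2]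
      rw [h3]
      linarith
    · intro a
      exact Finset.sum_nonneg fun s _ => mul_nonneg ((hσ' k).1 a s) (by linarith [(hb01 s).2])
    · intro a
      have : 0 ≤ ∑ s, σk' k a s * b k s :=
        Finset.sum_nonneg fun s _ => mul_nonneg ((hσ' k).1 a s) (hb01 s).1
      linarith [h1g a]
    · rw [hsw]
      refine Finset.sum_nonneg fun s _ => ?_
      change 0 ≤ m (μk k) (h k) (σk' k) s * _
      by_cases hs : m (μk k) (h k) (σk' k) s < 0
      · simp [b, hs]
      · simpa [b, hs] using not_lt.mp hs
    · simp only [h1g]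
      rw [hsw]
      refine Finset.sum_nonpos fun s _ => ?_
      change m (μk k) (h k) (σk' k) s * _ ≤ 0
      by_cases hs : m (μk k) (h k) (σk' k) s < 0
      · simpa [b, hs] using hs.le
      · simp [b, hs]

end
end Aux

open Finset in
/-- Theorem 1. For independent locations, if each `σ_k` is an optimal
solution of the isolated LP for `(μ_k, h_k)` (with optimal value
`Th_k^iso = ∑_{ω_k} μ_k(ω_k) σ_k(1|ω_k)`), then the product mechanism `σ` admits an
optimal strategy `f ∈ F_d` with `T(σ, f) = 1 − ∏_k (1 − Th_k^iso)`, and every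
decentralized mechanism `σ'` with an optimal strategy `f'` has
`T(σ', f') ≤ 1 − ∏_k (1 − Th_k^iso)`. -/
theorem stmt5 {K : ℕ} (hK : 1 ≤ K) {Ω : Fin K → Type} [∀ k, Fintype (Ω k)]
    [∀ k, Nonempty (Ω k)]
    (μk : ∀ k, Ω k → ℝ) (hμ : ∀ k, IsDist (μk k))
    (h : ∀ k, Ω k → ℝ)
    (σk : ∀ k, Ω k → Bool → ℝ) (hσ : ∀ k, IsMech (σk k))
    (hfeas : ∀ k, IsoFeas (μk k) (h k) (fun ωk => σk k ωk true))
    (hopt : ∀ k, ∀ g : Ω k → ℝ, IsoFeas (μk k) (h k) g →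
      (∑ ωk, μk k ωk * g ωk) ≤ ∑ ωk, μk k ωk * σk k ωk true) :
    (∃ f : (Fin K → Bool) → Option (Fin K) → ℝ, InFd f ∧
        IsOptimal (fun ω => ∏ k, μk k (ω k)) h
          (fun ω u => ∏ k, σk k (ω k) (u k)) f ∧
        T (fun ω => ∏ k, μk k (ω k)) (fun ω u => ∏ k, σk k (ω k) (u k)) f =
          1 - ∏ k, (1 - ∑ ωk, μk k ωk * σk k ωk true)) ∧
      ∀ (Sk : Fin K → Type) [∀ k, Fintype (Sk k)] [∀ k, Nonempty (Sk k)]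
        (σk' : ∀ k, Ω k → Sk k → ℝ), (∀ k, IsMech (σk' k)) →
        ∀ f' : (∀ k, Sk k) → Option (Fin K) → ℝ, IsStrat K f' →
          IsOptimal (fun ω => ∏ k, μk k (ω k)) h
            (fun ω s => ∏ k, σk' k (ω k) (s k)) f' →
          T (fun ω => ∏ k, μk k (ω k)) (fun ω s => ∏ k, σk' k (ω k) (s k)) f' ≤
            1 - ∏ k, (1 - ∑ ωk, μk k ωk * σk k ωk true) := by
  refine ⟨Aux.part1 μk hμ h σk hσ hfeas, ?_⟩
  intro Sk _ _ σk' hσ' f' hf' ho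
  exact Aux.part2 μk hμ h σk hfeas hopt Sk σk' hσ' f' hf' ho
end

section
/- Suppose the locations are independent. Then for every obedient direct mechanism σ, 1 − ∏_{k=1}^K (1 − Th_k^iso) ≥ (1 − (1 − 1/K)^K) · ∑_{ω∈Ω} ∑_{k=1}^K μ(ω)σ(k|ω). (Since the left-hand side equals the optimal decentralized throughput Th_D and the right-hand side's sum is maximized by the optimal centralized throughput Th, this yields Th_D ≥ (1 − (1 − 1/K)^K)·Th.) -/
/-- The product weight is invariant under swapping coordinate `k` with a fresh copy. -/
lemma swap_weight {K : ℕ} {Ω : Fin K → Type} (μk : ∀ k, Ω k → ℝ) (k : Fin K)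
    (a : Ω k) (ω : ∀ k, Ω k) :
    μk k (ω k) * ∏ j, μk j (Function.update ω k a j) = μk k a * ∏ j, μk j (ω j) := by
  rw [← Finset.mul_prod_erase Finset.univ _ (Finset.mem_univ k),
    ← Finset.mul_prod_erase Finset.univ (fun j => μk j (ω j)) (Finset.mem_univ k)]
  have : ∏ j ∈ Finset.univ.erase k, μk j (Function.update ω k a j)
      = ∏ j ∈ Finset.univ.erase k, μk j (ω j) := by
    refine Finset.prod_congr rfl fun j hj => ?_
    rw [Function.update_of_ne (Finset.ne_of_mem_erase hj)]
  rw [this, Function.update_self]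
  ring

/-- Resampling coordinate `k` does not change expectations. -/
lemma resample {K : ℕ} {Ω : Fin K → Type} [∀ k, Fintype (Ω k)]
    (μk : ∀ k, Ω k → ℝ) (hμ : ∀ k, IsDist (μk k)) (k : Fin K) (F : (∀ k, Ω k) → ℝ) :
    ∑ a, ∑ ω : ∀ k, Ω k, μk k a * (∏ j, μk j (ω j)) * F (Function.update ω k a)
      = ∑ ω, (∏ j, μk j (ω j)) * F ω := by
  have e : ∑ p : Ω k × (∀ k, Ω k), μk k p.1 * (∏ j, μk j (p.2 j)) * F (Function.update p.2 k p.1)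
      = ∑ p : Ω k × (∀ k, Ω k), μk k p.1 * (∏ j, μk j (p.2 j)) * F p.2 := by
    have hinv : Function.Involutive
        (fun p : Ω k × (∀ k, Ω k) => (p.2 k, Function.update p.2 k p.1)) := by
      rintro ⟨a, ω⟩
      simp
    refine Fintype.sum_equiv hinv.toPerm _ _ ?_
    rintro ⟨a, ω⟩
    simp only [Function.Involutive.coe_toPerm]
    rw [swap_weight]
  rw [Fintype.sum_prod_type, Fintype.sum_prod_type] at e
  rw [e, Finset.sum_comm]
  refine Finset.sum_congr rfl fun ω _ => ?_
  simp_rw [mul_assoc]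
  rw [← Finset.sum_mul, (hμ k).2, one_mul]

lemma le_thIso {α : Type} [Fintype α] (ν h : α → ℝ) (hν : IsDist ν) (g : α → ℝ)
    (hg : IsoFeas ν h g) : ∑ a, ν a * g a ≤ ThIso ν h := by
  refine le_csSup ⟨1, ?_⟩ ⟨g, hg, rfl⟩
  rintro x ⟨g, hg, rfl⟩
  rw [← hν.2]
  exact Finset.sum_le_sum fun a _ => mul_le_of_le_one_right (hν.1 a) (hg.2.1 a)

lemma thIso_le_one {α : Type} [Fintype α] (ν h : α → ℝ) (hν : IsDist ν) :
    ThIso ν h ≤ 1 := by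
  refine Real.sSup_le ?_ zero_le_one
  rintro x ⟨g, hg, rfl⟩
  rw [← hν.2]
  exact Finset.sum_le_sum fun a _ => mul_le_of_le_one_right (hν.1 a) (hg.2.1 a)

/-- The second constraint of the isolated program is redundant. -/
lemma le_thIso_relaxed {α : Type} [Fintype α] (ν h : α → ℝ) (hν : IsDist ν) (g : α → ℝ)
    (h0 : ∀ a, 0 ≤ g a) (h1 : ∀ a, g a ≤ 1) (hg : 0 ≤ ∑ a, ν a * g a * h a) :
    ∑ a, ν a * g a ≤ ThIso ν h := by
  by_cases hE : 0 ≤ ∑ a, ν a * h a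
  · have := le_thIso ν h hν (fun _ => 1) ⟨by simp, by simp, by simpa using hE, by simp⟩
    refine le_trans ?_ this
    exact Finset.sum_le_sum fun a _ => mul_le_mul_of_nonneg_left (h1 a) (hν.1 a)
  · refine le_thIso ν h hν g ⟨h0, h1, hg, ?_⟩
    have : ∑ a, ν a * (1 - g a) * h a = ∑ a, ν a * h a - ∑ a, ν a * g a * h a := by
      rw [← Finset.sum_sub_distrib]
      exact Finset.sum_congr rfl fun a _ => by ring
    linarith

lemma prod_bound {K : ℕ} (hK : 1 ≤ K) (p : Fin K → ℝ) (h0 : ∀ k, 0 ≤ p k)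
    (hs : ∑ k, p k ≤ 1) :
    ∏ k, (1 - p k) ≤ 1 - (1 - (1 - 1 / (K : ℝ)) ^ K) * ∑ k, p k := by
  have hKr : (1 : ℝ) ≤ K := by exact_mod_cast hK
  have hK0 : (K : ℝ) ≠ 0 := by positivity
  have hp1 : ∀ k, p k ≤ 1 := fun k =>
    (Finset.single_le_sum (fun i _ => h0 i) (Finset.mem_univ k)).trans hs
  set P := ∑ k, p k with hP
  have hP0 : 0 ≤ P := Finset.sum_nonneg fun k _ => h0 k
  have amgm : ∏ k, (1 - p k) ≤ (1 - P / K) ^ K := by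
    have hz : ∀ k ∈ (Finset.univ : Finset (Fin K)), 0 ≤ 1 - p k :=
      fun k _ => sub_nonneg.2 (hp1 k)
    have hw := Real.geom_mean_le_arith_mean_weighted Finset.univ (fun _ => 1 / (K : ℝ))
      (fun k => 1 - p k) (fun _ _ => by positivity) (by simp [hK0]) hz
    rw [Real.finsetProd_rpow _ _ hz, ← Finset.mul_sum, Finset.sum_sub_distrib, ← hP] at hw
    have hn := Finset.prod_nonneg hz
    have h2 := pow_le_pow_left₀ (Real.rpow_nonneg hn _) hw K
    rw [← Real.rpow_natCast, ← Real.rpow_mul hn, one_div_mul_cancel hK0, Real.rpow_one] at h2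
    have e : 1 / (K : ℝ) * (∑ _k : Fin K, (1 : ℝ) - P) = 1 - P / K := by
      simp only [Finset.sum_const, Finset.card_univ, Fintype.card_fin, nsmul_eq_mul, mul_one]
      field_simp
    rwa [e] at h2
  have conv : (1 - P / K) ^ K ≤ (1 - P) * 1 ^ K + P * (1 - 1 / (K : ℝ)) ^ K := by
    have hc := (convexOn_pow (𝕜 := ℝ) K).2 (x := 1) (y := 1 - 1 / (K : ℝ)) (by simp)
      (by
        have : 1 / (K : ℝ) ≤ 1 := by rw [div_le_one (by positivity)]; exact hKr
        simpa using this)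
      (sub_nonneg.2 hs) hP0 (by ring)
    simp only [smul_eq_mul] at hc
    have e : (1 - P) * 1 + P * (1 - 1 / (K : ℝ)) = 1 - P / K := by ring
    rwa [e] at hc
  rw [one_pow] at conv
  linarith

open Finset in
/-- core of Theorem 2. For independent locations and any obedient
direct mechanism `σ`,
`1 − ∏_k (1 − Th_k^iso) ≥ (1 − (1 − 1/K)^K) · ∑_ω ∑_k μ(ω) σ(k|ω)`. -/
theorem stmt6 {K : ℕ} (hK : 1 ≤ K) {Ω : Fin K → Type} [∀ k, Fintype (Ω k)]
    [∀ k, Nonempty (Ω k)]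
    (μk : ∀ k, Ω k → ℝ) (hμ : ∀ k, IsDist (μk k))
    (h : ∀ k, Ω k → ℝ)
    (σ : (∀ k, Ω k) → Option (Fin K) → ℝ) (hmech : IsMech σ)
    (hob : Obedient (fun ω => ∏ k, μk k (ω k)) h σ) :
    1 - ∏ k, (1 - ThIso (μk k) (h k)) ≥
      (1 - (1 - 1 / (K : ℝ)) ^ K) *
        ∑ ω, ∑ k : Fin K, (∏ j, μk j (ω j)) * σ ω (some k) := by
  classical
  have hw0 : ∀ ω : ∀ k, Ω k, 0 ≤ ∏ j, μk j (ω j) := fun ω =>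
    Finset.prod_nonneg fun j _ => (hμ j).1 _
  have hw1 : ∑ ω : ∀ k, Ω k, ∏ j, μk j (ω j) = 1 := by
    rw [← Fintype.piFinset_univ, ← Finset.prod_univ_sum]
    exact Finset.prod_eq_one fun j _ => (hμ j).2
  have hσ1 : ∀ ω, ∑ k, σ ω (some k) ≤ 1 := fun ω => by
    have := hmech.2 ω
    rw [Fintype.sum_option] at this
    linarith [hmech.1 ω none]
  have hσk : ∀ ω k, σ ω (some k) ≤ 1 := fun ω k =>
    (Finset.single_le_sum (f := fun k => σ ω (some k)) (fun i _ => hmech.1 ω _)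
      (Finset.mem_univ k)).trans (hσ1 ω)
  have key : ∀ k, ∑ ω, (∏ j, μk j (ω j)) * σ ω (some k) ≤ ThIso (μk k) (h k) := by
    intro k
    have hr := le_thIso_relaxed (μk k) (h k) (hμ k)
      (fun a => ∑ ω : ∀ k, Ω k, (∏ j, μk j (ω j)) * σ (Function.update ω k a) (some k))
      (fun a => Finset.sum_nonneg fun ω _ => mul_nonneg (hw0 ω) (hmech.1 _ _))
      (fun a => by
        rw [← hw1]
        exact Finset.sum_le_sum fun ω _ => mul_le_of_le_one_right (hw0 ω) (hσk _ _))
      (by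
        have h1 := hob.2.1 k
        have h2 := resample μk hμ k (fun ω => σ ω (some k) * h k (ω k))
        simp only [Function.update_self] at h2
        simp only [mul_assoc] at h1 h2
        rw [← h2] at h1
        simpa only [Finset.mul_sum, Finset.sum_mul, mul_assoc] using h1)
    have h2 := resample μk hμ k (fun ω => σ ω (some k))
    rw [← h2]
    simpa only [Finset.mul_sum, mul_assoc] using hr
  rw [Finset.sum_comm]
  have hb := prod_bound hK (fun k => ∑ ω, (∏ j, μk j (ω j)) * σ ω (some k))
    (fun k => Finset.sum_nonneg fun ω _ => mul_nonneg (hw0 ω) (hmech.1 _ _))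
    (by
      rw [Finset.sum_comm, ← hw1]
      refine Finset.sum_le_sum fun ω _ => ?_
      rw [← Finset.mul_sum]
      exact mul_le_of_le_one_right (hw0 ω) (hσ1 ω))
  have hm : ∏ k, (1 - ThIso (μk k) (h k))
      ≤ ∏ k, (1 - ∑ ω, (∏ j, μk j (ω j)) * σ ω (some k)) :=
    Finset.prod_le_prod (fun k _ => sub_nonneg.2 (thIso_le_one _ _ (hμ k)))
      fun k _ => by linarith [key k]
  linarith
end

section
/- Let ν be a probability distribution on a finite nonempty set Ω' and h : Ω' → ℝ. Let g : Ω' → [0,1] satisfy ∑_{ω∈Ω'} ν(ω)g(ω)h(ω) ≥ 0. Then the optimal value Th^iso(ν,h) of the isolated linear program satisfies Th^iso(ν,h) ≥ ∑_{ω∈Ω'} ν(ω)g(ω). -/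
open Finset in
/-- If `g : Ω' → [0,1]` satisfies `∑ ν(ω) g(ω) h(ω) ≥ 0`, then the
optimal value of the isolated LP satisfies `Th^iso(ν,h) ≥ ∑ ν(ω) g(ω)`. -/
theorem stmt7 {α : Type} [Fintype α] [Nonempty α] (ν h : α → ℝ) (hν : IsDist ν)
    (g : α → ℝ) (hg0 : ∀ a, 0 ≤ g a) (hg1 : ∀ a, g a ≤ 1)
    (hgh : 0 ≤ ∑ a, ν a * g a * h a) :
    ThIso ν h ≥ ∑ a, ν a * g a := by
  classical
  obtain ⟨hν0, hν1⟩ := hν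
  let g' : α → ℝ := fun a => if 0 ≤ h a then 1 else g a
  have hle : ∀ a, g a ≤ g' a := by
    intro a
    by_cases ha : 0 ≤ h a
    · simpa [g', ha] using hg1 a
    · simp [g', ha]
  have hle1 : ∀ a, g' a ≤ 1 := by
    intro a
    by_cases ha : 0 ≤ h a
    · simp [g', ha]
    · simpa [g', ha] using hg1 a
  have hfeas : IsoFeas ν h g' := by
    refine ⟨fun a => (hg0 a).trans (hle a), hle1, hgh.trans ?_, ?_⟩
    · refine Finset.sum_le_sum fun a _ => ?_
      by_cases ha : 0 ≤ h a
      · exact mul_le_mul_of_nonneg_right (mul_le_mul_of_nonneg_left (hle a) (hν0 a)) ha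
      · simp [g', ha]
    · refine Finset.sum_nonpos fun a _ => ?_
      by_cases ha : 0 ≤ h a
      · simp [g', ha]
      · exact mul_nonpos_of_nonneg_of_nonpos
          (mul_nonneg (hν0 a) (sub_nonneg.2 (hle1 a))) (not_le.1 ha).le
  have hbdd : BddAbove {x | ∃ g, IsoFeas ν h g ∧ x = ∑ a, ν a * g a} := by
    refine ⟨1, ?_⟩
    rintro x ⟨k, hk, rfl⟩
    rw [← hν1]
    exact Finset.sum_le_sum fun a _ => mul_le_of_le_one_right (hν0 a) (hk.2.1 a)
  calc ∑ a, ν a * g a ≤ ∑ a, ν a * g' a :=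
        Finset.sum_le_sum fun a _ => mul_le_mul_of_nonneg_left (hle a) (hν0 a)
    _ ≤ ThIso ν h := le_csSup hbdd ⟨g', hfeas, rfl⟩
end

section
/- Let 0 ≤ p ≤ 1 and X > 0. Consider the isolated linear program for the distribution ν on {0,1} with ν(1) = p and ν(0) = 1 − p, and the utility h with h(1) = X and h(0) = −1. Then its optimal value satisfies Th^iso(ν,h) = min{1, p(X+1)}. -/
/-- For the two-state isolated LP with `ν(1) = p`, `ν(0) = 1 − p`,
`h(1) = X > 0`, `h(0) = −1`, the optimal value is `min{1, p(X+1)}`. -/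
theorem stmt10 (p X : ℝ) (hp0 : 0 ≤ p) (hp1 : p ≤ 1) (hX : 0 < X) :
    ThIso (fun b : Bool => if b then p else 1 - p)
        (fun b : Bool => if b then X else -1) =
      min 1 (p * (X + 1)) := by
  apply IsGreatest.csSup_eq
  constructor
  · by_cases hc : 1 ≤ p * (X + 1)
    · refine ⟨fun _ => 1, ⟨fun _ => by norm_num, fun _ => by norm_num, ?_, ?_⟩, ?_⟩
      · simp only [Fintype.sum_bool, if_true, Bool.false_eq_true, if_false]
        linarith
      · simp
      · rw [min_eq_left hc]
        simp
    · have hc' : p * (X + 1) < 1 := not_le.mp hc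
      have hpX : 0 ≤ p * X := mul_nonneg hp0 hX.le
      have hq : 0 < 1 - p := by linarith
      have hm : (1 - p) * (p * X / (1 - p)) = p * X := by
        field_simp
      refine ⟨fun b => if b then 1 else p * X / (1 - p), ⟨?_, ?_, ?_, ?_⟩, ?_⟩
      · intro b
        cases b
        · simpa using div_nonneg hpX hq.le
        · simp
      · intro b
        cases b
        · simp only [Bool.false_eq_true, if_false]
          rw [div_le_one hq]
          linarith
        · simp
      · simp only [Fintype.sum_bool, if_true, Bool.false_eq_true, if_false]
        linarith
      · simp only [Fintype.sum_bool, if_true, Bool.false_eq_true, if_false]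
        linarith
      · simp only [Fintype.sum_bool, if_true, Bool.false_eq_true, if_false]
        rw [min_eq_right hc'.le]
        linarith
  · rintro x ⟨g, ⟨_, h1, h2, _⟩, rfl⟩
    simp only [Fintype.sum_bool, if_true, Bool.false_eq_true, if_false] at h2 ⊢
    have ht := mul_le_mul_of_nonneg_left (h1 true) hp0
    have hf := mul_le_mul_of_nonneg_left (h1 false) (sub_nonneg.mpr hp1)
    have htX := mul_le_mul_of_nonneg_right ht hX.le
    apply le_min <;> linarith
end

section
/- Let ν be a probability distribution on a finite nonempty set Ω' and h : Ω' → ℝ. Assume ∑_{ω∈Ω'} ν(ω)h(ω) < 0 and that there exists ω̄ ∈ Ω' with ν(ω̄) > 0 and h(ω̄) ≥ 0. Then the optimal value Th^iso(ν,h) of the isolated linear program satisfies 0 < Th^iso(ν,h) < 1, and every optimal solution σ satisfies ∑_{ω} ν(ω)σ(1|ω)h(ω) = 0 and ∑_{ω} ν(ω)σ(0|ω)h(ω) < 0. -/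
open Finset in
/-- If `∑ ν h < 0` and some state has positive probability and
nonnegative utility, then `0 < Th^iso(ν,h) < 1` and every optimal solution `g` of the
isolated LP satisfies `∑ ν g h = 0` and `∑ ν (1−g) h < 0`. -/
theorem stmt11 {α : Type} [Fintype α] [Nonempty α] (ν h : α → ℝ) (hν : IsDist ν)
    (hneg : (∑ a, ν a * h a) < 0) (hex : ∃ a, 0 < ν a ∧ 0 ≤ h a) :
    0 < ThIso ν h ∧ ThIso ν h < 1 ∧
      ∀ g : α → ℝ, IsoFeas ν h g → (∑ a, ν a * g a) = ThIso ν h →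
        (∑ a, ν a * g a * h a) = 0 ∧ (∑ a, ν a * (1 - g a) * h a) < 0 := by
  classical
  obtain ⟨hν0, hν1⟩ := hν
  have hsplit : ∀ g : α → ℝ, ∑ a, ν a * (1 - g a) * h a
      = ∑ a, ν a * h a - ∑ a, ν a * g a * h a := by
    intro g
    rw [← Finset.sum_sub_distrib]
    exact Finset.sum_congr rfl fun a _ => by ring
  have hone : ∀ g : α → ℝ, 1 - ∑ a, ν a * g a = ∑ a, ν a * (1 - g a) := by
    intro g
    calc 1 - ∑ a, ν a * g a = ∑ a, ν a - ∑ a, ν a * g a := by rw [hν1]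
      _ = _ := by
        rw [← Finset.sum_sub_distrib]
        exact Finset.sum_congr rfl fun a _ => by ring
  set H := ∑ a, ν a * h a with hH
  set M := ∑ a, |h a| + 1 with hM
  have hMh : ∀ a, |h a| ≤ M := by
    intro a
    have := Finset.single_le_sum (f := fun a => |h a|) (fun i _ => abs_nonneg _)
      (Finset.mem_univ a)
    linarith
  have hMpos : 0 < M := by
    have : 0 ≤ ∑ a, |h a| := Finset.sum_nonneg fun i _ => abs_nonneg _
    linarith
  have hbound : ∀ g : α → ℝ, IsoFeas ν h g → ∑ a, ν a * g a ≤ 1 + H / M := by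
    intro g hg
    obtain ⟨g0, g1, hg1, hg2⟩ := hg
    have h1 : -M * (1 - ∑ a, ν a * g a) ≤ ∑ a, ν a * (1 - g a) * h a := by
      rw [hone, Finset.mul_sum]
      apply Finset.sum_le_sum
      intro a _
      have h2 : 0 ≤ ν a * (1 - g a) := mul_nonneg (hν0 a) (by linarith [g1 a])
      have h3 : -M ≤ h a := by linarith [neg_abs_le (h a), hMh a]
      nlinarith
    rw [hsplit] at h1
    have h4 : -H / M ≤ 1 - ∑ a, ν a * g a := by
      rw [div_le_iff₀ hMpos]; linarith
    rw [neg_div] at h4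
    linarith
  have hbdd : BddAbove {x | ∃ g, IsoFeas ν h g ∧ x = ∑ a, ν a * g a} := by
    refine ⟨1 + H / M, ?_⟩
    rintro x ⟨g, hg, rfl⟩
    exact hbound g hg
  have hle : ∀ g : α → ℝ, IsoFeas ν h g → ∑ a, ν a * g a ≤ ThIso ν h :=
    fun g hg => le_csSup hbdd ⟨g, hg, rfl⟩
  obtain ⟨b, hb, hhb⟩ := hex
  have hfeas : IsoFeas ν h (fun a => if a = b then 1 else 0) := by
    have hs : ∑ a, ν a * (if a = b then (1:ℝ) else 0) * h a = ν b * h b := by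
      simp
    refine ⟨fun a => by dsimp only; split_ifs <;> norm_num,
      fun a => by dsimp only; split_ifs <;> norm_num, ?_, ?_⟩
    · rw [hs]; positivity
    · rw [hsplit, hs]
      have : 0 ≤ ν b * h b := by positivity
      linarith
  have hlt : ThIso ν h < 1 := by
    have h1 : ThIso ν h ≤ 1 + H / M := by
      refine csSup_le ⟨_, ⟨_, hfeas, rfl⟩⟩ ?_
      rintro x ⟨g, hg, rfl⟩
      exact hbound g hg
    have := div_neg_of_neg_of_pos hneg hMpos
    linarith
  refine ⟨?_, hlt, ?_⟩
  · have := hle _ hfeas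
    simp at this
    linarith
  · intro g hg hopt
    obtain ⟨g0, g1, hg1, hg2⟩ := hg
    refine ⟨?_, by rw [hsplit]; linarith⟩
    by_contra hne
    set G := ∑ a, ν a * g a * h a with hG
    have hGpos : 0 < G := lt_of_le_of_ne hg1 (Ne.symm hne)
    have hd : 0 < G - H := by linarith
    obtain ⟨t, ht⟩ : ∃ t, t = G / (G - H) := ⟨_, rfl⟩
    have ht0 : 0 < t := by rw [ht]; positivity
    have ht1 : t ≤ 1 := by rw [ht, div_le_one hd]; linarith
    have htG : t * (G - H) = G := by rw [ht]; field_simp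
    have hs : ∑ a, ν a * (g a + t * (1 - g a)) * h a = 0 := by
      have : ∑ a, ν a * (g a + t * (1 - g a)) * h a
          = G + t * ∑ a, ν a * (1 - g a) * h a := by
        rw [hG, Finset.mul_sum, ← Finset.sum_add_distrib]
        exact Finset.sum_congr rfl fun a _ => by ring
      rw [this, hsplit]
      linarith
    have hf : IsoFeas ν h (fun a => g a + t * (1 - g a)) := by
      refine ⟨fun a => ?_, fun a => ?_, ?_, ?_⟩
      · have := mul_nonneg ht0.le (sub_nonneg.2 (g1 a))
        linarith [g0 a]
      · nlinarith [g1 a]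
      · rw [hs]
      · rw [hsplit, hs]; linarith
    have h5 := hle _ hf
    have h6 : ∑ a, ν a * (g a + t * (1 - g a))
        = ∑ a, ν a * g a + t * (1 - ∑ a, ν a * g a) := by
      rw [hone, Finset.mul_sum, ← Finset.sum_add_distrib]
      exact Finset.sum_congr rfl fun a _ => by ring
    rw [h6, hopt] at h5
    have := mul_pos ht0 (sub_pos.2 hlt)
    linarith
end

section
/- Let μ be an arbitrary joint probability distribution on Ω = Ω_1 × ⋯ × Ω_K (no independence assumed). Then for every obedient direct mechanism σ there exist finite signal sets S_1, …, S_K, a decentralized signaling mechanism ψ with signal set S = S_1 × ⋯ × S_K, and a strategy f on S that is optimal under ψ, such that T(ψ, f) ≥ (1/K) · ∑_{ω∈Ω} ∑_{k=1}^K μ(ω)σ(k|ω). Consequently the optimal decentralized throughput Th_D and optimal centralized throughput Th satisfy Th_D ≥ Th/K. -/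
open Finset in
/-- Existence of a decentralized mechanism with signal sets `Sk` achieving throughput at
least `c`, via a strategy that is optimal under it. -/
def HasGoodDec (K : ℕ) {Ω : Fin K → Type} [∀ k, Fintype (Ω k)]
    (μ : (∀ k, Ω k) → ℝ) (h : ∀ k, Ω k → ℝ) (c : ℝ)
    (Sk : Fin K → Type) [∀ k, Fintype (Sk k)] [∀ k, Nonempty (Sk k)] : Prop :=
  ∃ ψk : ∀ k, Ω k → Sk k → ℝ, (∀ k, IsMech (ψk k)) ∧
    ∃ f : (∀ k, Sk k) → Option (Fin K) → ℝ, IsStrat K f ∧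
      IsOptimal μ h (fun ω s => ∏ k, ψk k (ω k) (s k)) f ∧
      c ≤ T μ (fun ω s => ∏ k, ψk k (ω k) (s k)) f

open Finset in
/-- Conditional expectation given `π a`. -/
lemma exists_condexp {A B : Type} [Fintype A] [Fintype B] (π : A → B) (m s : A → ℝ)
    (hm : ∀ a, 0 ≤ m a) (hs0 : ∀ a, 0 ≤ s a) (hs1 : ∀ a, s a ≤ 1) :
    ∃ g : B → ℝ, (∀ b, 0 ≤ g b) ∧ (∀ b, g b ≤ 1) ∧
      ∀ φ : B → ℝ, ∑ a, m a * g (π a) * φ (π a) = ∑ a, m a * s a * φ (π a) := by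
  classical
  have hle : ∀ b, ∑ a with π a = b, m a * s a ≤ ∑ a with π a = b, m a := fun b =>
    sum_le_sum fun a _ => mul_le_of_le_one_right (hm a) (hs1 a)
  have h0 : ∀ b, 0 ≤ ∑ a with π a = b, m a * s a := fun b =>
    sum_nonneg fun a _ => mul_nonneg (hm a) (hs0 a)
  have h0' : ∀ b, 0 ≤ ∑ a with π a = b, m a := fun b => sum_nonneg fun a _ => hm a
  refine ⟨fun b => (∑ a with π a = b, m a * s a) / ∑ a with π a = b, m a,
    fun b => div_nonneg (h0 b) (h0' b), fun b => div_le_one_of_le₀ (hle b) (h0' b), fun φ => ?_⟩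
  rw [← sum_fiberwise univ π, ← sum_fiberwise univ π (fun a => m a * s a * φ (π a))]
  refine sum_congr rfl fun b _ => ?_
  have e1 : ∑ a with π a = b, m a * s a * φ (π a) = (∑ a with π a = b, m a * s a) * φ b := by
    rw [sum_mul]
    refine sum_congr rfl fun a ha => ?_
    rw [(mem_filter.1 ha).2]
  rw [e1]
  set N := ∑ a with π a = b, m a * s a with hN
  set D := ∑ a with π a = b, m a with hD
  have e2 : ∑ a with π a = b, m a * ((∑ a' with π a' = π a, m a' * s a') /
      ∑ a' with π a' = π a, m a') * φ (π a) = D * (N / D) * φ b := by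
    rw [hD, sum_mul, sum_mul]
    refine sum_congr rfl fun a ha => ?_
    rw [(mem_filter.1 ha).2]
  rw [e2]
  by_cases hz : D = 0
  · have : N = 0 := le_antisymm (hz ▸ hle b) (h0 b)
    rw [this, hz]; simp
  · rw [mul_div_cancel₀ _ hz]

open Finset in
/-- An optimal action that joins whenever joining is optimal. -/
lemma exists_action {K : ℕ} (V : Option (Fin K) → ℝ) :
    ∃ a, (∀ a', V a' ≤ V a) ∧ ((∃ k, V none ≤ V (some k)) → a ≠ none) := by
  by_cases hex : ∃ k : Fin K, V none ≤ V (some k)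
  · obtain ⟨k, hk⟩ := hex
    haveI : Nonempty (Fin K) := ⟨k⟩
    obtain ⟨j, hj⟩ := Finite.exists_max fun j : Fin K => V (some j)
    refine ⟨some j, ?_, fun _ => by simp⟩
    rintro (_ | l)
    · exact hk.trans (hj k)
    · exact hj l
  · obtain ⟨a, ha⟩ := Finite.exists_max V
    exact ⟨a, ha, fun h => absurd h hex⟩

open Finset in
/-- Theorem 5. For an arbitrary joint distribution `μ` (no
independence) and any obedient direct mechanism `σ`, there exist finite signal sets, a
decentralized mechanism `ψ`, and a strategy `f` optimal under `ψ`, with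
`T(ψ, f) ≥ (1/K) · ∑_ω ∑_k μ(ω)σ(k|ω)`; hence `Th_D ≥ Th/K`. -/
theorem stmt13 {K : ℕ} (hK : 1 ≤ K) {Ω : Fin K → Type} [∀ k, Fintype (Ω k)]
    [∀ k, Nonempty (Ω k)]
    (μ : (∀ k, Ω k) → ℝ) (hμ : IsDist μ)
    (h : ∀ k, Ω k → ℝ)
    (σ : (∀ k, Ω k) → Option (Fin K) → ℝ) (hmech : IsMech σ)
    (hob : Obedient μ h σ) :
    ∃ (Sk : Fin K → Type) (instF : ∀ k, Fintype (Sk k)) (instN : ∀ k, Nonempty (Sk k)),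
      @HasGoodDec K Ω _ μ h
        ((1 / (K : ℝ)) * ∑ ω, ∑ k : Fin K, μ ω * σ ω (some k)) Sk instF instN := by
  classical
  haveI : Nonempty (Fin K) := ⟨⟨0, hK⟩⟩
  obtain ⟨hμ0, -⟩ := hμ
  obtain ⟨hσ0, hσ1⟩ := hmech
  obtain ⟨-, hob, -⟩ := hob
  obtain ⟨k0, hk0⟩ := Finite.exists_max fun k : Fin K => ∑ ω, μ ω * σ ω (some k)
  obtain ⟨g, hg0, hg1, hg⟩ := exists_condexp (fun ω : ∀ k, Ω k => ω k0) μ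
    (fun ω => σ ω (some k0)) hμ0 (fun ω => hσ0 ω _)
    (fun ω => (hσ1 ω) ▸ single_le_sum (fun a _ => hσ0 ω a) (mem_univ (some k0)))
  have hg' : ∀ φ : Ω k0 → ℝ, ∑ ω, μ ω * g (ω k0) * φ (ω k0)
      = ∑ ω, μ ω * σ ω (some k0) * φ (ω k0) := hg
  refine ⟨fun _ => Bool, fun _ => inferInstance, fun _ => inferInstance, ?_⟩
  let G : ∀ k, Ω k → ℝ := fun k x => if e : k = k0 then g (e ▸ x) else 1
  have hG0 : ∀ k x, 0 ≤ G k x := by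
    intro k x; simp only [G]; split_ifs
    · exact hg0 _
    · exact zero_le_one
  have hG1 : ∀ k x, G k x ≤ 1 := by
    intro k x; simp only [G]; split_ifs
    · exact hg1 _
    · exact le_rfl
  let ψ : ∀ k, Ω k → Bool → ℝ := fun k x b => if b then G k x else 1 - G k x
  have hψ0 : ∀ k x b, 0 ≤ ψ k x b := by
    intro k x b
    cases b
    · simpa [ψ] using hG1 k x
    · simpa [ψ] using hG0 k x
  let P : (∀ k, Ω k) → (Fin K → Bool) → ℝ := fun ω s => ∏ k, ψ k (ω k) (s k)
  have hP0 : ∀ ω s, 0 ≤ P ω s := fun ω s => prod_nonneg fun k _ => hψ0 _ _ _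
  let t : Fin K → Bool := fun _ => true
  have hPt : ∀ ω, P ω t = g (ω k0) := by
    intro ω
    have : P ω t = ∏ k, G k (ω k) := by simp [P, ψ, t]
    rw [this, prod_eq_single k0]
    · simp [G]
    · intro k _ hk; simp [G, hk]
    · simp
  choose act hact1 hact2 using fun s : Fin K → Bool =>
    exists_action fun a => ∑ ω, μ ω * P ω s * util h ω a
  have htj : act t ≠ none := by
    apply hact2 t
    refine ⟨k0, ?_⟩
    simp only [util, hPt]
    rw [hg' (h k0)]
    simpa using hob k0
  refine ⟨ψ, fun k => ⟨hψ0 k, fun x => by simp [ψ]⟩,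
    fun s a => if a = act s then 1 else 0, ⟨?_, ?_⟩, ?_, ?_⟩
  · intro s a
    dsimp only
    split_ifs <;> norm_num
  · intro s; simp
  · intro s _ a ha a'
    have : a = act s := by
      by_contra hne
      simp [hne] at ha
    rw [this]
    exact hact1 s a'
  · obtain ⟨j, hj⟩ := Option.ne_none_iff_exists'.1 htj
    have hb : (1 / (K : ℝ)) * ∑ ω, ∑ k : Fin K, μ ω * σ ω (some k)
        ≤ ∑ ω, μ ω * σ ω (some k0) := by
      rw [sum_comm]
      have hKpos : (0 : ℝ) < K := by exact_mod_cast hK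
      rw [one_div, inv_mul_le_iff₀ hKpos]
      calc ∑ k : Fin K, ∑ ω, μ ω * σ ω (some k)
          ≤ ∑ _k : Fin K, ∑ ω, μ ω * σ ω (some k0) := sum_le_sum fun k _ => hk0 k
        _ = K * ∑ ω, μ ω * σ ω (some k0) := by simp
    refine hb.trans ?_
    have hone := hg' fun _ => 1
    simp only [mul_one] at hone
    rw [← hone]
    unfold T
    refine sum_le_sum fun ω _ => ?_
    have hnn : ∀ s k, 0 ≤ μ ω * P ω s * (if some k = act s then (1 : ℝ) else 0) := fun s k =>
      mul_nonneg (mul_nonneg (hμ0 ω) (hP0 ω s)) (by split_ifs <;> norm_num)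
    calc μ ω * g (ω k0) = μ ω * P ω t * (if some j = act t then (1 : ℝ) else 0) := by
          rw [hPt, hj]; simp
      _ ≤ ∑ k, μ ω * P ω t * (if some k = act t then (1 : ℝ) else 0) :=
          single_le_sum (f := fun k => μ ω * P ω t * (if some k = act t then (1 : ℝ) else 0))
            (fun k _ => hnn t k) (mem_univ j)
      _ ≤ ∑ s, ∑ k, μ ω * P ω s * (if some k = act s then (1 : ℝ) else 0) :=
          single_le_sum
            (f := fun s => ∑ k, μ ω * P ω s * (if some k = act s then (1 : ℝ) else 0))
            (fun s _ => sum_nonneg fun k _ => hnn s k) (mem_univ t)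
end

section
/- For every integer K ≥ 2, the unique z* ∈ [0,1] satisfying z* = (1 − z*)^{K−1} satisfies z* ≤ (log K)/(K − 1). In particular z* = O((log K)/K) as K → ∞. -/
/-- For every integer `K ≥ 2`, the unique `z* ∈ [0,1]` with
`z* = (1 − z*)^{K−1}` satisfies `z* ≤ (log K)/(K − 1)`; in particular
`z* = O((log K)/K)`. -/
theorem stmt16 (K : ℕ) (hK : 2 ≤ K) (z : ℝ) (hz : z ∈ Set.Icc (0 : ℝ) 1)
    (hzeq : z = (1 - z) ^ (K - 1)) :
    z ≤ Real.log K / ((K : ℝ) - 1) := by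
  obtain ⟨h0, h1⟩ := hz
  have hK2 : (2 : ℝ) ≤ K := by exact_mod_cast hK
  have hKpos : (0 : ℝ) < K := by linarith
  have hn : (0 : ℝ) < (K : ℝ) - 1 := by linarith
  have hlog : 1 - (K : ℝ)⁻¹ ≤ Real.log K := Real.one_sub_inv_le_log_of_pos hKpos
  rw [le_div_iff₀ hn]
  by_contra! hlt
  have hcast : ((K - 1 : ℕ) : ℝ) = (K : ℝ) - 1 := by
    rw [Nat.cast_sub (by omega)]; simp
  have hexp : z ≤ Real.exp (-(z * ((K : ℝ) - 1))) := by
    calc z = (1 - z) ^ (K - 1) := hzeq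
      _ ≤ (Real.exp (-z)) ^ (K - 1) :=
          pow_le_pow_left₀ (by linarith) (Real.one_sub_le_exp_neg z) _
      _ = Real.exp (-(z * ((K : ℝ) - 1))) := by
          rw [← Real.exp_nat_mul, hcast]; congr 1; ring
  have hlt2 : Real.exp (-(z * ((K : ℝ) - 1))) < (K : ℝ)⁻¹ := by
    calc Real.exp (-(z * ((K : ℝ) - 1))) < Real.exp (-Real.log K) :=
          Real.exp_lt_exp.mpr (by linarith)
      _ = (K : ℝ)⁻¹ := by rw [Real.exp_neg, Real.exp_log hKpos]
  have h3 : z * ((K : ℝ) - 1) < (K : ℝ)⁻¹ * ((K : ℝ) - 1) :=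
    mul_lt_mul_of_pos_right (lt_of_le_of_lt hexp hlt2) hn
  have h4 : (K : ℝ)⁻¹ * ((K : ℝ) - 1) = 1 - (K : ℝ)⁻¹ := by
    field_simp
  linarith
end

section
/- Let K ≥ 2 be an integer and let z*_K be the unique solution in [0,1] of z = (1 − z)^{K−1}. Then for every u = (u_1, …, u_K) ∈ [0,1]^K, ∑_{k=1}^K min{ u_k, ( 1 − (1/(K−1)) ∑_{ℓ ≠ k} u_ℓ )^{K−1} } ≤ K z*_K. -/
open Finset

lemma pow_sub_le_aux (a b : ℝ) (ha : 0 ≤ a) (hab : a ≤ b) (hb : b ≤ 1) (n : ℕ) :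
    b ^ n - a ^ n ≤ n * (b - a) := by
  induction n with
  | zero => simp
  | succ n ih =>
    have h1 : a ^ n ≤ 1 := pow_le_one₀ ha (hab.trans hb)
    have h2 : a ^ n ≤ b ^ n := pow_le_pow_left₀ ha hab n
    have h3 : b * (b ^ n - a ^ n) ≤ 1 * (b ^ n - a ^ n) :=
      mul_le_mul_of_nonneg_right hb (by linarith)
    have h4 : a ^ n * (b - a) ≤ 1 * (b - a) :=
      mul_le_mul_of_nonneg_right h1 (by linarith)
    push_cast
    rw [pow_succ, pow_succ]
    linarith

/-- For `K ≥ 2`, `z*_K` the unique solution in `[0,1]` of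
`z = (1 − z)^{K−1}`, and any `u ∈ [0,1]^K`,
`∑_k min{u_k, (1 − (1/(K−1)) ∑_{ℓ≠k} u_ℓ)^{K−1}} ≤ K z*_K`. -/
theorem stmt17 (K : ℕ) (hK : 2 ≤ K) (z : ℝ) (hz0 : 0 ≤ z) (hz1 : z ≤ 1)
    (hzeq : z = (1 - z) ^ (K - 1))
    (u : Fin K → ℝ) (hu : ∀ k, u k ∈ Set.Icc (0 : ℝ) 1) :
    (∑ k, min (u k)
        ((1 - (1 / ((K : ℝ) - 1)) * ∑ l ∈ univ.erase k, u l) ^ (K - 1))) ≤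
      (K : ℝ) * z := by
  obtain ⟨n, rfl⟩ : ∃ n, K = n + 1 := ⟨K - 1, by omega⟩
  have hn : (0 : ℝ) < n := by exact_mod_cast (by omega : 0 < n)
  have hc : (((n + 1 : ℕ) : ℝ) - 1) = n := by push_cast; ring
  simp only [Nat.add_sub_cancel] at hzeq ⊢
  rw [hc]
  have hbase : ∀ k, 0 ≤ 1 - (1 / (n : ℝ)) * ∑ l ∈ univ.erase k, u l := by
    intro k
    have h : ∑ l ∈ univ.erase k, u l ≤ n := by
      calc ∑ l ∈ univ.erase k, u l ≤ ∑ l ∈ univ.erase k, (1 : ℝ) :=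
            Finset.sum_le_sum fun l _ => (hu l).2
        _ = n := by simp [Finset.card_erase_of_mem]
    have : (1 / (n : ℝ)) * ∑ l ∈ univ.erase k, u l ≤ 1 := by
      rw [one_div, inv_mul_le_iff₀ hn]; linarith
    linarith
  set v : Fin (n + 1) → ℝ := fun k => min (u k)
    ((1 - (1 / (n : ℝ)) * ∑ l ∈ univ.erase k, u l) ^ n) with hv
  have hv0 : ∀ k, 0 ≤ v k := fun k => le_min (hu k).1 (pow_nonneg (hbase k) n)
  change ∑ k, v k ≤ _
  by_cases hall : ∀ k, v k ≤ z
  · calc ∑ k, v k ≤ ∑ k : Fin (n + 1), z := Finset.sum_le_sum fun k _ => hall k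
      _ = _ := by simp
  · push Not at hall
    obtain ⟨k, hk⟩ := hall
    set T := ∑ l ∈ univ.erase k, v l with hT
    have hT0 : 0 ≤ T := Finset.sum_nonneg fun l _ => hv0 l
    have hTu : T ≤ ∑ l ∈ univ.erase k, u l :=
      Finset.sum_le_sum fun l _ => min_le_left _ _
    have hS : ∑ k, v k = v k + T := (Finset.add_sum_erase _ _ (mem_univ k)).symm
    obtain ⟨y, hy⟩ : ∃ y, y = 1 - (1 / (n : ℝ)) * T := ⟨_, rfl⟩
    have hin : 0 ≤ 1 / (n : ℝ) := by positivity
    have hyu : 1 - (1 / (n : ℝ)) * ∑ l ∈ univ.erase k, u l ≤ y := by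
      have := mul_le_mul_of_nonneg_left hTu hin
      linarith
    have hy0 : 0 ≤ y := (hbase k).trans hyu
    have hy1 : y ≤ 1 := by
      have := mul_nonneg hin hT0
      linarith
    have hvy : v k ≤ y ^ n :=
      (min_le_right _ _).trans (pow_le_pow_left₀ (hbase k) hyu n)
    have hzy : 1 - z ≤ y := by
      by_contra hcon
      push Not at hcon
      have := pow_le_pow_left₀ hy0 hcon.le n
      linarith
    have hp := pow_sub_le_aux (1 - z) y (by linarith) hzy hy1 n
    have hTy : T = n * (1 - y) := by
      rw [hy]; field_simp; ring
    rw [hS, hTy]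
    push_cast
    rw [← hzeq] at hp
    linarith
end

section
/- Define F : [0,1]^K → ℝ by F(u) = ∑_{k=1}^K min{ u_k, (1 − (1/(K−1))∑_{ℓ≠k} u_ℓ)^{K−1} } for an integer K ≥ 2, and define A(u) = { k ∈ {1,…,K} : u_k ≤ (1 − (1/(K−1))∑_{ℓ≠k} u_ℓ)^{K−1} }. Then the maximum of F over [0,1]^K is attained at some u* ∈ [0,1]^K satisfying (a) A(u*) = {1,…,K} and (b) u*_k = u*_ℓ for all k, ℓ ∈ {1,…,K}. -/
open Finset

/-- The objective `F(u) = ∑_k min{u_k, (1 − (1/(K−1)) ∑_{ℓ≠k} u_ℓ)^{K−1}}`. -/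
noncomputable def Fobj (K : ℕ) (u : Fin K → ℝ) : ℝ :=
  ∑ k, min (u k) ((1 - (1 / ((K : ℝ) - 1)) * ∑ l ∈ univ.erase k, u l) ^ (K - 1))

lemma aux_exp (n : ℕ) (hn : 6 ≤ n) :
    (1 + 1 / (n : ℝ)) ^ (n - 1) * (1 + n / 3) ≤ n + 1 := by
  have hn' : (6 : ℝ) ≤ n := by exact_mod_cast hn
  have h0 : (0 : ℝ) < n := by linarith
  have h1 : (1 + 1 / (n : ℝ)) ^ n ≤ 2.7182818286 := by
    have h2 : 1 + 1 / (n : ℝ) ≤ Real.exp (1 / n) := by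
      have := Real.add_one_le_exp (1 / (n : ℝ))
      linarith
    have h3 : (1 + 1 / (n : ℝ)) ^ n ≤ Real.exp (1 / n) ^ n := by gcongr
    have h4 : Real.exp (1 / (n : ℝ)) ^ n = Real.exp 1 := by
      rw [← Real.exp_nat_mul]
      congr 1
      field_simp
    have h5 := Real.exp_one_lt_d9
    linarith
  have h6 : (1 + 1 / (n : ℝ)) ^ n = (1 + 1 / (n : ℝ)) ^ (n - 1) * (1 + 1 / (n : ℝ)) := by
    rw [← pow_succ]
    congr 1
    omega
  rw [h6] at h1
  set P := (1 + 1 / (n : ℝ)) ^ (n - 1) with hP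
  have h7 : P * (n + 1) ≤ 2.7182818286 * n := by
    have : P * (n + 1) = (P * (1 + 1 / (n : ℝ))) * n := by field_simp
    rw [this]
    gcongr
  have h8 : (P * (1 + n / 3)) * (n + 1) ≤ (n + 1) * (n + 1) := by
    have : (P * (1 + n / 3)) * (n + 1) = (P * (n + 1)) * (1 + n / 3) := by ring
    rw [this]
    have : (P * (n + 1)) * (1 + n / 3) ≤ (2.7182818286 * n) * (1 + n / 3) := by gcongr
    nlinarith
  exact le_of_mul_le_mul_right h8 (by linarith)

lemma aux_D (n : ℕ) (hn : 1 ≤ n) (q δ : ℝ) (hδ : 0 < δ) (hq0 : 0 < q) (hq : q ^ n = 1 - q)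
    (h : 1 ≤ (1 + δ) ^ (n - 1) * δ) : q ^ (n - 1) ≤ δ := by
  obtain ⟨m, rfl⟩ : ∃ m, n = m + 1 := ⟨n - 1, by omega⟩
  simp only [Nat.add_sub_cancel] at *
  by_contra hc
  push Not at hc
  have h1 : q * (1 + δ) < 1 := by
    have : q ^ (m + 1) = q ^ m * q := pow_succ q m
    nlinarith
  have h2 : (q * (1 + δ)) ^ m ≤ 1 := pow_le_one₀ (by positivity) h1.le
  rw [mul_pow] at h2
  have h3 : δ * (1 + δ) ^ m < q ^ m * (1 + δ) ^ m := by gcongr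
  linarith

lemma aux_core (n : ℕ) (hn : 2 ≤ n) (p q : ℝ) (hp : 0 ≤ p) (hpq : p ≤ q) (hq0 : 0 < q)
    (hq1 : q < 1) (hq : q ^ n = 1 - q) (r : ℝ) (hr0 : 0 ≤ r) (hr : r ≤ (1 + 1 / (n : ℝ)) * q) :
    (1 + ∑ i ∈ range n, q ^ i * p ^ (n - 1 - i)) * ∑ i ∈ range n, r ^ i * p ^ (n - 1 - i)
      ≤ (n + 1) * ∑ i ∈ range n, q ^ i * p ^ (n - 1 - i) := by
  have hD0 : 0 ≤ ∑ i ∈ range n, q ^ i * p ^ (n - 1 - i) :=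
    sum_nonneg fun i _ => by positivity
  have hT : ∑ i ∈ range n, r ^ i * p ^ (n - 1 - i) ≤
      ∑ i ∈ range n, ((1 + 1 / (n : ℝ)) * q) ^ i * p ^ (n - 1 - i) := by
    gcongr
  refine (mul_le_mul_of_nonneg_left hT (by linarith)).trans ?_
  by_cases h2 : n = 2
  · subst h2
    simp [sum_range_succ]
    have : q ≤ 0.7 := by nlinarith
    have : 0.6 ≤ q := by nlinarith
    nlinarith [mul_nonneg hp (sub_nonneg.2 hpq), mul_nonneg hp hq0.le]
  by_cases h3 : n = 3
  · subst h3
    simp [sum_range_succ]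
    have : q ≤ 0.69 := by nlinarith [sq_nonneg q, sq_nonneg (q + 0.69)]
    obtain ⟨t, rfl⟩ : ∃ t, p = t * q := ⟨p / q, by field_simp⟩
    have ht0 : 0 ≤ t := by
      by_contra h; push Not at h; nlinarith
    have ht1 : t ≤ 1 := by
      by_contra h; push Not at h; nlinarith
    have hqq : q ^ 2 ≤ 0.4761 := by nlinarith
    have key : (1 + q ^ 2 * (1 + t + t ^ 2)) * (16 / 9 + 4 / 3 * t + t ^ 2)
        ≤ 4 * (1 + t + t ^ 2) := by
      have h1 : (1 + q ^ 2 * (1 + t + t ^ 2)) * (16 / 9 + 4 / 3 * t + t ^ 2) ≤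
        (1 + 0.4761 * (1 + t + t ^ 2)) * (16 / 9 + 4 / 3 * t + t ^ 2) := by gcongr
      have ht2 : t ^ 2 ≤ t := by nlinarith
      have ht3 : t ^ 3 ≤ t ^ 2 := by nlinarith [sq_nonneg t]
      have ht4 : t ^ 4 ≤ t ^ 2 := by nlinarith [sq_nonneg t]
      nlinarith
    have := mul_le_mul_of_nonneg_left key (sq_nonneg q)
    nlinarith
  have h4 : 4 ≤ n := by omega
  have hn0 : (0 : ℝ) < n := by positivity
  have hTD : ∑ i ∈ range n, ((1 + 1 / (n : ℝ)) * q) ^ i * p ^ (n - 1 - i) ≤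
      (1 + 1 / (n : ℝ)) ^ (n - 1) * ∑ i ∈ range n, q ^ i * p ^ (n - 1 - i) := by
    rw [mul_sum]
    refine sum_le_sum fun i hi => ?_
    rw [mul_pow, mul_assoc]
    have : i ≤ n - 1 := by have := mem_range.1 hi; omega
    have h1 : (1 : ℝ) ≤ 1 + 1 / (n : ℝ) := by
      have : 0 ≤ 1 / (n : ℝ) := by positivity
      linarith
    gcongr
  have hDq : ∑ i ∈ range n, q ^ i * p ^ (n - 1 - i) ≤ n * q ^ (n - 1) := by
    have : ∑ i ∈ range n, q ^ i * p ^ (n - 1 - i) ≤ ∑ i ∈ range n, q ^ (n - 1) := by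
      refine sum_le_sum fun i hi => ?_
      have : n - 1 = i + (n - 1 - i) := by have := mem_range.1 hi; omega
      conv_rhs => rw [this, pow_add]
      gcongr
    simpa using this
  set D := ∑ i ∈ range n, q ^ i * p ^ (n - 1 - i) with hD
  have key : (1 + 1 / (n : ℝ)) ^ (n - 1) * (1 + n * q ^ (n - 1)) ≤ n + 1 := by
    by_cases h5 : n = 4
    · subst h5
      have := aux_D 4 (by norm_num) q 0.39 (by norm_num) hq0 hq (by norm_num)
      norm_num at this ⊢
      linarith
    have h6 := aux_D n (by omega) q (1 / 3) (by norm_num) hq0 hq (by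
      have : (1 + 1 / 3 : ℝ) ^ 4 ≤ (1 + 1 / 3 : ℝ) ^ (n - 1) :=
        pow_le_pow_right₀ (by norm_num) (by omega)
      norm_num at this ⊢
      linarith)
    by_cases h5 : n = 5
    · subst h5
      norm_num at h6 ⊢
      linarith
    refine le_trans ?_ (aux_exp n (by omega))
    have : (n : ℝ) * q ^ (n - 1) ≤ n / 3 := by nlinarith
    gcongr
  calc _ ≤ (1 + D) * ((1 + 1 / (n : ℝ)) ^ (n - 1) * D) := by gcongr
    _ = ((1 + 1 / (n : ℝ)) ^ (n - 1) * (1 + D)) * D := by ring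
    _ ≤ ((1 + 1 / (n : ℝ)) ^ (n - 1) * (1 + n * q ^ (n - 1))) * D := by gcongr
    _ ≤ _ := by gcongr

lemma aux_q (n : ℕ) (hn : 1 ≤ n) : ∃ q : ℝ, 0 < q ∧ q < 1 ∧ q ^ n = 1 - q := by
  have hc : ContinuousOn (fun q : ℝ => q ^ n + q) (Set.Icc 0 1) := by fun_prop
  have := intermediate_value_Icc (zero_le_one) hc
  have h1 : (1 : ℝ) ∈ Set.Icc ((0 : ℝ) ^ n + 0) (1 ^ n + 1) := by
    rw [zero_pow (by omega)]; norm_num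
  obtain ⟨q, ⟨h0, h1⟩, hq⟩ := this h1
  simp only at hq
  refine ⟨q, lt_of_le_of_ne h0 ?_, lt_of_le_of_ne h1 ?_, by linarith⟩
  · rintro rfl
    rw [zero_pow (by omega)] at hq; norm_num at hq
  · rintro rfl
    norm_num at hq

lemma aux_main (n : ℕ) (hn : 1 ≤ n) (q : ℝ) (hq0 : 0 < q) (hq1 : q < 1) (hq : q ^ n = 1 - q)
    (u : Fin (n + 1) → ℝ) (hu : ∀ k, u k ∈ Set.Icc (0 : ℝ) 1) :
    ∑ k, min (u k) ((1 - (∑ l, u l - u k) / n) ^ n) ≤ (n + 1) * (1 - q) := by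
  have hn0 : (0 : ℝ) < n := by exact_mod_cast hn
  set S := ∑ l, u l with hS
  have hSn : ∀ k, S - u k ≤ n := by
    intro k
    have : S = u k + ∑ l ∈ univ.erase k, u l := (add_sum_erase _ _ (mem_univ k)).symm
    have h2 : ∑ l ∈ univ.erase k, u l ≤ ∑ l ∈ univ.erase k, 1 :=
      sum_le_sum fun l _ => (hu l).2
    simp at h2
    linarith
  rcases le_or_gt S ((n + 1) * (1 - q)) with hle | hgt
  · exact (sum_le_sum fun k _ => min_le_left _ _).trans hle
  have hz : ∀ k, 0 ≤ 1 - (S - u k) / n := by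
    intro k
    have : (S - u k) / n ≤ 1 := (div_le_one hn0).2 (hSn k)
    linarith
  by_cases h1 : n = 1
  · subst h1
    refine (sum_le_sum fun k _ => min_le_right _ _).trans ?_
    simp only [Nat.cast_one, div_one, pow_one] at *
    rw [Fin.sum_univ_two] at *
    linarith
  have h2 : 2 ≤ n := by omega
  have h2' : (2 : ℝ) ≤ n := by exact_mod_cast h2
  rcases le_or_gt (n : ℝ) S with hb | hb
  · have hqn : 1 / (n : ℝ) ≤ q := by
      by_contra h
      push Not at h
      have h3 : q ^ n ≤ q := pow_le_of_le_one hq0.le hq1.le (by omega)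
      have : 1 / (n : ℝ) ≤ 1 / 2 := by gcongr
      linarith
    have : ∀ k ∈ (univ : Finset (Fin (n + 1))),
        min (u k) ((1 - (S - u k) / n) ^ n) ≤ 1 - q := by
      intro k _
      refine (min_le_right _ _).trans ?_
      rw [← hq]
      refine pow_le_pow_left₀ (hz k) (le_trans ?_ hqn) n
      rw [le_div_iff₀ hn0]
      have : (1 - (S - u k) / n) * n = n - (S - u k) := by field_simp
      rw [this]
      linarith [(hu k).2]
    refine (sum_le_sum this).trans ?_
    simp
    linarith
  -- the crossing point
  obtain ⟨p, ⟨hp0, hpq⟩, hp⟩ : ∃ p ∈ Set.Icc 0 q, p ^ n + n * (1 - p) = S := by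
    have hc : ContinuousOn (fun p : ℝ => p ^ n + n * (1 - p)) (Set.Icc 0 q) := by fun_prop
    refine intermediate_value_Icc' hq0.le hc ⟨?_, ?_⟩
    · simp only [hq]; linarith
    · simp only [zero_pow (show n ≠ 0 by omega)]; linarith
  have hx0 : 0 ≤ p ^ n := by positivity
  have hx1 : p ^ n ≤ 1 := pow_le_one₀ hp0 (by linarith)
  set r := p + (1 - p ^ n) / n with hr
  have hpr : p ≤ r := by
    have : 0 ≤ (1 - p ^ n) / n := div_nonneg (by linarith) hn0.le
    linarith
  have hr0 : 0 ≤ r := by linarith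
  have hr1 : r ≤ 1 := by
    have hb := one_add_mul_le_pow (show (-2 : ℝ) ≤ p - 1 by linarith) n
    have h3 : (1 - p ^ n) / n ≤ 1 - p := by
      rw [div_le_iff₀ hn0]
      have : (1 + (p - 1)) = p := by ring
      rw [this] at hb
      linarith
    linarith
  set D := ∑ i ∈ range n, q ^ i * p ^ (n - 1 - i) with hD
  set T := ∑ i ∈ range n, r ^ i * p ^ (n - 1 - i) with hT
  have hDn : D ≤ n := by
    have : D ≤ ∑ i ∈ range n, (1 : ℝ) := sum_le_sum fun i _ =>
      mul_le_one₀ (pow_le_one₀ hq0.le hq1.le) (by positivity) (pow_le_one₀ hp0 (by linarith))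
    simpa using this
  have hTn : T ≤ n := by
    have : T ≤ ∑ i ∈ range n, (1 : ℝ) := sum_le_sum fun i _ =>
      mul_le_one₀ (pow_le_one₀ hr0 hr1) (by positivity) (pow_le_one₀ hp0 (by linarith))
    simpa using this
  have hDmul : D * (q - p) = q ^ n - p ^ n := (Commute.all q p).geom_sum₂_mul n
  have hrq : r ≤ (1 + 1 / (n : ℝ)) * q := by
    have h3 : (1 - p ^ n) = q + D * (q - p) := by rw [hDmul, hq]; ring
    have h4 : D * (q - p) ≤ n * (q - p) := by
      apply mul_le_mul_of_nonneg_right hDn; linarith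
    rw [hr, h3]
    have h5 : (q + D * (q - p)) / n ≤ (q + n * (q - p)) / n := by gcongr
    have h6 : (q + n * (q - p)) / n = q / n + (q - p) := by field_simp
    have h7 : (1 + 1 / (n : ℝ)) * q = q + q / n := by ring
    linarith
  have hcore := aux_core n h2 p q hp0 hpq hq0 hq1 hq r hr0 hrq
  rw [← hD, ← hT] at hcore
  have hline : ∀ k ∈ (univ : Finset (Fin (n + 1))),
      min (u k) ((1 - (S - u k) / n) ^ n) ≤ p ^ n + (T / n) * (u k - p ^ n) := by
    intro k _
    rcases le_or_gt (u k) (p ^ n) with h | h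
    · refine (min_le_left _ _).trans ?_
      have : T / n ≤ 1 := (div_le_one hn0).2 hTn
      nlinarith
    · refine (min_le_right _ _).trans ?_
      have e : 1 - (S - u k) / n = p + (u k - p ^ n) / n := by
        rw [← hp]; field_simp; ring
      rw [e]
      set z := p + (u k - p ^ n) / n with hzz
      have hpz : p ≤ z := by
        have : 0 ≤ (u k - p ^ n) / n := div_nonneg (by linarith) hn0.le
        linarith
      have hz0 : 0 ≤ z := by linarith
      have hzr : z ≤ r := by
        rw [hzz, hr]; gcongr; exact (hu k).2
      have hm : (∑ i ∈ range n, z ^ i * p ^ (n - 1 - i)) * (z - p) = z ^ n - p ^ n :=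
        (Commute.all z p).geom_sum₂_mul n
      have hle : (∑ i ∈ range n, z ^ i * p ^ (n - 1 - i)) ≤ T := by
        rw [hT]; gcongr
      have h3 := mul_le_mul_of_nonneg_right hle (sub_nonneg.2 hpz)
      have h4 : T / n * (u k - p ^ n) = T * (z - p) := by rw [hzz]; ring
      linarith
  refine (sum_le_sum hline).trans ?_
  rw [sum_add_distrib, ← mul_sum, sum_sub_distrib, ← hS]
  simp only [sum_const, card_univ, Fintype.card_fin, nsmul_eq_mul]
  push_cast
  have e1 : S - (n + 1) * p ^ n = n * ((q - p) * (1 + D)) := by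
    have : (q - p) * (1 + D) = 1 - p - p ^ n := by linarith
    rw [this, ← hp]; ring
  rw [e1]
  have e2 : T / n * (n * ((q - p) * (1 + D))) = (q - p) * ((1 + D) * T) := by
    field_simp
  rw [e2]
  have h9 := mul_le_mul_of_nonneg_left hcore (sub_nonneg.2 hpq)
  have : (q - p) * ((n + 1) * D) = (n + 1) * (1 - q - p ^ n) := by
    rw [← hq, ← hDmul]; ring
  linarith

/-- For `K ≥ 2`, the maximum of `F` over `[0,1]^K` is attained at some
`u*` with `A(u*) = {1,…,K}` (i.e. `u*_k ≤ (1 − (1/(K−1)) ∑_{ℓ≠k} u*_ℓ)^{K−1}` for all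
`k`) and with all coordinates equal. -/
theorem stmt18 (K : ℕ) (hK : 2 ≤ K) :
    ∃ ustar : Fin K → ℝ, (∀ k, ustar k ∈ Set.Icc (0 : ℝ) 1) ∧
      (∀ u : Fin K → ℝ, (∀ k, u k ∈ Set.Icc (0 : ℝ) 1) → Fobj K u ≤ Fobj K ustar) ∧
      (∀ k, ustar k ≤
        (1 - (1 / ((K : ℝ) - 1)) * ∑ l ∈ univ.erase k, ustar l) ^ (K - 1)) ∧
      (∀ k l, ustar k = ustar l) := by
  obtain ⟨n, rfl⟩ : ∃ n, K = n + 1 := ⟨K - 1, by omega⟩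
  have hn : 1 ≤ n := by omega
  have hn0 : (0 : ℝ) < n := by exact_mod_cast hn
  obtain ⟨q, hq0, hq1, hq⟩ := aux_q n hn
  have hval : ∀ k : Fin (n + 1), (1 - (1 / (((n + 1 : ℕ) : ℝ) - 1)) *
      ∑ l ∈ univ.erase k, (1 - q)) ^ (n + 1 - 1) = 1 - q := by
    intro k
    rw [← hq, Nat.add_sub_cancel]
    congr 1
    simp
    field_simp
    linarith
  refine ⟨fun _ => 1 - q, fun k => ⟨by linarith, by linarith⟩, ?_, ?_, fun _ _ => rfl⟩
  · intro u hu
    have h := aux_main n hn q hq0 hq1 hq u hu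
    have e1 : Fobj (n + 1) (fun _ => 1 - q) = (n + 1) * (1 - q) := by
      unfold Fobj
      simp only [hval]
      simp
      ring
    rw [e1]
    refine le_trans (le_of_eq ?_) h
    unfold Fobj
    refine sum_congr rfl fun k _ => ?_
    rw [← add_sum_erase _ u (mem_univ k)]
    congr 2
    push_cast
    ring
  · intro k
    exact (hval k).ge
end

section
/- The centralized persuasion problem is solved by the obedient-direct-mechanism linear program. Precisely: (1) for every obedient direct mechanism σ, the obedient strategy f_ob on signal set {0,1,…,K}, defined by f_ob(a|a) = 1 for all a, is optimal under σ (viewing σ as a signaling mechanism with signal set {0,1,…,K}), and T(σ, f_ob) = ∑_{ω∈Ω} ∑_{k=1}^K μ(ω)σ(k|ω); and (2) for every finite signal set S, every signaling mechanism σ on S, and every strategy f on S that is optimal under σ, there exists an obedient direct mechanism σ' with ∑_{ω∈Ω} ∑_{k=1}^K μ(ω)σ'(k|ω) ≥ T(σ, f). Hence the supremum of T(σ, f) over all finite signal sets S, signaling mechanisms σ on S, and strategies f optimal under σ equals the maximum of the linear program over obedient direct mechanisms. -/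
open Finset in
/-- The centralized persuasion problem is solved by the
obedient-direct-mechanism LP: (1) for every obedient direct mechanism `σ`, the obedient
strategy `f_ob` (follow the recommendation) is optimal under `σ` and
`T(σ, f_ob) = ∑_ω ∑_k μ(ω)σ(k|ω)`; (2) for every signaling mechanism `σ` on a finite
signal set `S` and every strategy `f` optimal under `σ`, there is an obedient direct
mechanism `σ'` with `∑_ω ∑_k μ(ω)σ'(k|ω) ≥ T(σ, f)`. -/
theorem stmt19 {K : ℕ} (hK : 1 ≤ K) {Ω : Fin K → Type} [∀ k, Fintype (Ω k)]
    [∀ k, Nonempty (Ω k)]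
    (μ : (∀ k, Ω k) → ℝ) (hμ : IsDist μ)
    (h : ∀ k, Ω k → ℝ) :
    (∀ σ : (∀ k, Ω k) → Option (Fin K) → ℝ, IsMech σ → Obedient μ h σ →
      IsOptimal μ h σ (fun s a => if a = s then 1 else 0) ∧
        T μ σ (fun s a => if a = s then 1 else 0) =
          ∑ ω, ∑ k : Fin K, μ ω * σ ω (some k)) ∧
    ∀ (S : Type) [Fintype S] [Nonempty S] (σ : (∀ k, Ω k) → S → ℝ), IsMech σ →
      ∀ f : S → Option (Fin K) → ℝ, IsStrat K f → IsOptimal μ h σ f →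
        ∃ σ' : (∀ k, Ω k) → Option (Fin K) → ℝ, IsMech σ' ∧ Obedient μ h σ' ∧
          T μ σ f ≤ ∑ ω, ∑ k : Fin K, μ ω * σ' ω (some k) := by
  obtain ⟨hμ0, -⟩ := hμ
  refine ⟨?_, ?_⟩
  · intro σ hσ ⟨h1, h2, h3⟩
    refine ⟨?_, ?_⟩
    · intro s _ a ha a'
      have has : a = s := by
        by_contra hne
        simp [hne] at ha
      subst has
      cases a with
      | none =>
        cases a' with
        | none => exact le_rfl
        | some l => simpa [util] using h3 l
      | some k =>
        cases a' with
        | none => simpa [util] using h2 k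
        | some l => exact h1 k l
    · unfold T
      refine Finset.sum_congr rfl fun ω _ => ?_
      rw [Finset.sum_comm]
      refine Finset.sum_congr rfl fun k _ => ?_
      simp
  · intro S _ _ σ hσ f hf hopt
    obtain ⟨hσ0, hσ1⟩ := hσ
    obtain ⟨hf0, hf1⟩ := hf
    have swap : ∀ a b, ∑ ω, μ ω * (∑ s, σ ω s * f s a) * util h ω b
        = ∑ s, f s a * ∑ ω, μ ω * σ ω s * util h ω b := by
      intro a b
      simp only [Finset.mul_sum, Finset.sum_mul]
      rw [Finset.sum_comm]
      refine Finset.sum_congr rfl fun s _ => Finset.sum_congr rfl fun ω _ => ?_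
      ring
    have key : ∀ a b, ∑ ω, μ ω * (∑ s, σ ω s * f s a) * util h ω b
        ≤ ∑ ω, μ ω * (∑ s, σ ω s * f s a) * util h ω a := by
      intro a b
      rw [swap, swap]
      refine Finset.sum_le_sum fun s _ => ?_
      have hnn : ∀ ω ∈ (Finset.univ : Finset (∀ k, Ω k)), 0 ≤ μ ω * σ ω s :=
        fun ω _ => mul_nonneg (hμ0 ω) (hσ0 ω s)
      rcases (Finset.sum_nonneg hnn).lt_or_eq with hpos | hz
      · rcases (hf0 s a).lt_or_eq with hfa | hfa
        · exact mul_le_mul_of_nonneg_left (hopt s hpos a hfa b) hfa.le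
        · rw [← hfa]; simp
      · have hz' := (Finset.sum_eq_zero_iff_of_nonneg hnn).1 hz.symm
        have hzero : ∀ c, ∑ ω, μ ω * σ ω s * util h ω c = 0 := fun c =>
          Finset.sum_eq_zero fun ω hω => by rw [hz' ω hω, zero_mul]
        rw [hzero, hzero]
    refine ⟨fun ω a => ∑ s, σ ω s * f s a, ⟨?_, ?_⟩, ⟨?_, ?_, ?_⟩, ?_⟩
    · exact fun ω a => Finset.sum_nonneg fun s _ => mul_nonneg (hσ0 ω s) (hf0 s a)
    · intro ω
      rw [Finset.sum_comm]
      simp only [← Finset.mul_sum, hf1, mul_one, hσ1]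
    · exact fun k l => key (some k) (some l)
    · intro k
      simpa [util] using key (some k) none
    · intro k
      simpa [util] using key none (some k)
    · unfold T
      refine le_of_eq (Finset.sum_congr rfl fun ω _ => ?_)
      rw [Finset.sum_comm]
      refine Finset.sum_congr rfl fun k _ => ?_
      rw [Finset.mul_sum]
      exact Finset.sum_congr rfl fun s _ => by ring
end
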